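/- arXiv:1404.3409 — 3 statements merged into one kernel-verified Lean document; each statement's English description precedes it below -/
import Mathlib

section
/- Let S(z)=∑_{k≥0} a_k z^k be a formal power series with complex coefficients, and let m,n be positive integers. Let P̂_m and Q̂_n be the Jacobi determinantal polynomials: Q̂_n(z) is the (n+1)×(n+1) determinant whose rows i=1,…,n are (a_{m−n+i}, a_{m−n+i+1}, …, a_{m+i}) and whose last row is (z^n, z^{n−1}, …, 1), and P̂_m(z) is the determinant with the same first n rows and last row (∑_{i=0}^{m−n} a_i z^{n+i}, ∑_{i=0}^{m−n+1} a_i z^{n+i−1}, …, ∑_{i=0}^{m} a_i z^i). Then the following are equivalent: (i) the Hankel determinant C_{m,n} is nonzero; (ii) the Padé approximant [S;m/n]=P_m/Q_n exists and deg P_m = m or deg Q_n = n; (iii) P̂_m and Q̂_n are coprime and deg P̂_m = m or deg Q̂_n = n; (iv) P̂_m and Q̂_n are coprime. If these hold, then P̂_m = Q̂_n(0)·P_m and Q̂_n = Q̂_n(0)·Q_n. Moreover, if C_{m,n}=0 and [S;m/n]=P_m/Q_n exists, then P̂_m = T·P_m and Q̂_n = T·Q_n for some polynomial T with T(0)=0.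 -/
open Polynomial Filter Finset Metric Topology

noncomputable section

/-- Coefficient sequence extended to integer indices, with `a k = 0` for `k < 0`. -/
def acoefZ (a : ℕ → ℂ) (k : ℤ) : ℂ := if 0 ≤ k then a k.toNat else 0

/-- The Hankel determinant `C_{m,n} = det (a_{m-n+1+i+j})_{0 ≤ i,j ≤ n-1}`. -/
def hankelDet (a : ℕ → ℂ) (m n : ℕ) : ℂ :=
  Matrix.det (Matrix.of fun i j : Fin n => acoefZ a ((m : ℤ) - n + 1 + i + j))

/-- `IsPade a m n P Q` : the rational function `P/Q` is the Padé approximant of type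
`(m,n)` of the formal power series `∑ a_k z^k`. -/
def IsPade (a : ℕ → ℂ) (m n : ℕ) (P Q : Polynomial ℂ) : Prop :=
  P.natDegree ≤ m ∧ Q.natDegree ≤ n ∧ IsCoprime P Q ∧ Q.coeff 0 = 1 ∧
    ∀ j ≤ m + n, (∑ i ∈ Finset.range (j + 1), Q.coeff i * a (j - i)) = P.coeff j

/-- `𝒟_{m,n}` : the set of coefficient sequences whose Hankel determinant `C_{m,n}`
does not vanish. -/
def Dset (m n : ℕ) : Set (ℕ → ℂ) := {a | hankelDet a m n ≠ 0}

/-- `𝒩_{m,n}` : the subset of `𝒟_{m,n}` of series whose Padé denominator has exact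
degree `n`. -/
def Nset (m n : ℕ) : Set (ℕ → ℂ) :=
  {a | hankelDet a m n ≠ 0 ∧
    ∃ P Q : Polynomial ℂ, IsPade a m n P Q ∧ Q.degree = (n : WithBot ℕ)}

/-- The open unit disc in `ℂ`. -/
def unitD : Set ℂ := Metric.ball (0 : ℂ) 1

/-- The submodule of `ℂ → ℂ` of functions holomorphic on `Ω` (normalized to vanish
outside `Ω`, so that a function is determined by its restriction to `Ω`). -/
def holSubmodule (Ω : Set ℂ) : Submodule ℂ (ℂ → ℂ) where
  carrier := {f | DifferentiableOn ℂ f Ω ∧ ∀ z ∉ Ω, f z = 0}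
  add_mem' := fun hf hg => ⟨hf.1.add hg.1, fun z hz => by simp [hf.2 z hz, hg.2 z hz]⟩
  zero_mem' := ⟨differentiableOn_const 0, fun _ _ => rfl⟩
  smul_mem' := fun c f hf => ⟨hf.1.const_smul c, fun z hz => by simp [hf.2 z hz]⟩

/-- `H(Ω)`, the space of holomorphic functions on `Ω`. -/
abbrev Hol (Ω : Set ℂ) := ↥(holSubmodule Ω)

/-- The topology of uniform convergence on compact subsets of `Ω` on `H(Ω)`. -/
instance holTop (Ω : Set ℂ) : TopologicalSpace (Hol Ω) :=
  TopologicalSpace.induced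
    (fun f : Hol Ω => UniformOnFun.ofFun {K : Set Ω | IsCompact K} fun z : Ω => f.1 z)
    inferInstance

/-- The `k`-th Taylor coefficient at `0` of a function `f`. -/
def tc (f : ℂ → ℂ) (k : ℕ) : ℂ := iteratedDeriv k f 0 / k.factorial

/-- The Jacobi determinantal denominator `Q̂_n`: the `(n+1) × (n+1)` determinant whose
rows `i = 0, …, n-1` are `(a_{m-n+1+i}, …, a_{m+1+i})` and whose last row is
`(z^n, z^{n-1}, …, 1)`. -/
def Qhat (a : ℕ → ℂ) (m n : ℕ) : Polynomial ℂ :=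
  Matrix.det (Matrix.of fun i j : Fin (n + 1) =>
    if (i : ℕ) < n then Polynomial.C (acoefZ a ((m : ℤ) - n + 1 + i + j))
    else Polynomial.X ^ (n - (j : ℕ)))

/-- The Jacobi determinantal numerator `P̂_m`: the `(n+1) × (n+1)` determinant with the
same first `n` rows as `Q̂_n` and last row
`(∑_{i=0}^{m-n} a_i z^{n+i}, ∑_{i=0}^{m-n+1} a_i z^{n+i-1}, …, ∑_{i=0}^{m} a_i z^i)`. -/
def Phat (a : ℕ → ℂ) (m n : ℕ) : Polynomial ℂ :=
  Matrix.det (Matrix.of fun i j : Fin (n + 1) =>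
    if (i : ℕ) < n then Polynomial.C (acoefZ a ((m : ℤ) - n + 1 + i + j))
    else ∑ t ∈ Finset.range (m + 1),
      if (t : ℤ) ≤ (m : ℤ) - n + (j : ℕ) then
        Polynomial.C (a t) * Polynomial.X ^ (n + t - (j : ℕ)) else 0)

/-- `P / Q` solves the linearized Padé problem of type `(m, n)` for `∑ a_k z^k`. -/
structure IsLinearPade (a : ℕ → ℂ) (m n : ℕ) (P Q : ℂ[X]) : Prop where
  natDegree_num_le : P.natDegree ≤ m
  natDegree_den_le : Q.natDegree ≤ n
  dvd : (PowerSeries.X : PowerSeries ℂ) ^ (m + n + 1) ∣ (Q : PowerSeries ℂ) * .mk a - P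

theorem PowerSeries.coeff_coe_mul_mk (a : ℕ → ℂ) (Q : ℂ[X]) (k : ℕ) :
    PowerSeries.coeff k ((Q : PowerSeries ℂ) * .mk a) =
      ∑ i ∈ Finset.range (k + 1), Q.coeff i * a (k - i) := by
  rw [PowerSeries.coeff_mul, Finset.Nat.sum_antidiagonal_eq_sum_range_succ_mk]
  simp

/-- Coefficients of `Q * S` in the column indexing of the Jacobi determinants. -/
theorem PowerSeries.coeff_coe_mul_mk_eq_sum_acoefZ (a : ℕ → ℂ) {n : ℕ} {Q : ℂ[X]}
    (hQ : Q.natDegree ≤ n) (k : ℕ) :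
    PowerSeries.coeff k ((Q : PowerSeries ℂ) * .mk a) =
      ∑ j : Fin (n + 1), Q.coeff (n - j) * acoefZ a ((k : ℤ) - n + j) := by
  have h₁ : ∀ N, k ≤ N → PowerSeries.coeff k ((Q : PowerSeries ℂ) * .mk a) =
      ∑ i ∈ Finset.range (N + 1), Q.coeff i * acoefZ a ((k : ℤ) - i) := by
    intro N hN
    rw [PowerSeries.coeff_coe_mul_mk]
    refine Finset.sum_subset_zero_on_sdiff (by simpa using hN) ?_ ?_
    · intro i hi
      have : ¬ (0 : ℤ) ≤ (k : ℤ) - i := by simp at hi; omega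
      rw [acoefZ, if_neg this, mul_zero]
    · intro i hi
      have h0 : (0 : ℤ) ≤ (k : ℤ) - i := by simp at hi; omega
      have h1 : ((k : ℤ) - i).toNat = k - i := by omega
      rw [acoefZ, if_pos h0, h1]
  have h₂ : ∑ i ∈ Finset.range (n + 1), Q.coeff i * acoefZ a ((k : ℤ) - i) =
      ∑ i ∈ Finset.range (max k n + 1), Q.coeff i * acoefZ a ((k : ℤ) - i) := by
    refine Finset.sum_subset (by simp) fun i _ hi => ?_
    rw [Polynomial.coeff_eq_zero_of_natDegree_lt (by simp at hi; omega), zero_mul]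
  rw [h₁ _ (le_max_left k n), ← h₂, ← Finset.sum_range_reflect, Finset.sum_range]
  refine Finset.sum_congr rfl fun j _ => ?_
  have hj := j.is_lt
  rw [show n + 1 - 1 - (j : ℕ) = n - j by omega, Nat.cast_sub (by omega)]
  ring_nf

theorem IsPade.isLinearPade {a : ℕ → ℂ} {m n : ℕ} {P Q : ℂ[X]} (h : IsPade a m n P Q) :
    IsLinearPade a m n P Q := by
  obtain ⟨hP, hQ, -, -, h⟩ := h
  refine ⟨hP, hQ, PowerSeries.X_pow_dvd_iff.2 fun j hj => ?_⟩
  rw [map_sub, PowerSeries.coeff_coe_mul_mk, h j (by omega), Polynomial.coeff_coe, sub_self]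

namespace IsLinearPade

variable {a : ℕ → ℂ} {m n : ℕ} {P Q P₁ Q₁ : ℂ[X]}

theorem coeff_eq (h : IsLinearPade a m n P Q) {j : ℕ} (hj : j ≤ m + n) :
    PowerSeries.coeff j ((Q : PowerSeries ℂ) * .mk a) = P.coeff j := by
  have := PowerSeries.X_pow_dvd_iff.1 h.dvd j (by omega)
  rwa [map_sub, Polynomial.coeff_coe, sub_eq_zero] at this

theorem isPade (h : IsLinearPade a m n P Q) (hc : IsCoprime P Q) (h0 : Q.coeff 0 = 1) :
    IsPade a m n P Q :=
  ⟨h.natDegree_num_le, h.natDegree_den_le, hc, h0, fun j hj => by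
    rw [← PowerSeries.coeff_coe_mul_mk, h.coeff_eq hj]⟩

theorem C_mul (h : IsLinearPade a m n P Q) (c : ℂ) :
    IsLinearPade a m n (C c * P) (C c * Q) := by
  refine ⟨(natDegree_C_mul_le _ _).trans h.natDegree_num_le,
    (natDegree_C_mul_le _ _).trans h.natDegree_den_le, ?_⟩
  convert h.dvd.mul_left (PowerSeries.C c) using 1
  push_cast
  ring

theorem mul_eq_mul (h : IsLinearPade a m n P Q) (h₁ : IsLinearPade a m n P₁ Q₁) :
    P₁ * Q = P * Q₁ := by
  have hd : (PowerSeries.X : PowerSeries ℂ) ^ (m + n + 1) ∣ ((P₁ * Q - P * Q₁ : ℂ[X]) :) := by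
    convert (h.dvd.mul_left (Q₁ : PowerSeries ℂ)).sub (h₁.dvd.mul_left (Q : PowerSeries ℂ)) using 1
    push_cast
    ring
  rw [← sub_eq_zero]
  ext k
  rw [coeff_zero]
  rcases lt_or_ge k (m + n + 1) with hk | hk
  · simpa only [Polynomial.coeff_coe] using PowerSeries.X_pow_dvd_iff.1 hd k hk
  · refine coeff_eq_zero_of_natDegree_lt (lt_of_le_of_lt (natDegree_sub_le_of_le
      (natDegree_mul_le_of_le h₁.natDegree_num_le h.natDegree_den_le)
      (natDegree_mul_le_of_le h.natDegree_num_le h₁.natDegree_den_le)) ?_)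
    simpa using hk

theorem exists_eq_mul (h₁ : IsLinearPade a m n P₁ Q₁) (h : IsPade a m n P Q) :
    ∃ T : ℂ[X], P₁ = T * P ∧ Q₁ = T * Q := by
  have he := h.isLinearPade.mul_eq_mul h₁
  obtain ⟨-, -, hc, h0, -⟩ := h
  have hQ : Q ≠ 0 := by rintro rfl; simp at h0
  obtain ⟨T, rfl⟩ : Q ∣ Q₁ := hc.symm.dvd_of_dvd_mul_left ⟨P₁, by rw [← he, mul_comm]⟩
  exact ⟨T, mul_right_cancel₀ hQ (by rw [he]; ring), mul_comm _ _⟩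

theorem eq_zero_of_coeff_zero (h : IsLinearPade a m n P Q) (hH : hankelDet a m n ≠ 0)
    (h0 : Q.coeff 0 = 0) : Q = 0 := by
  have hv : (fun j : Fin n => Q.coeff (n - j)) = 0 := by
    by_contra hne
    refine hH (Matrix.exists_mulVec_eq_zero_iff.1 ⟨_, hne, ?_⟩)
    ext i
    have hi := i.is_lt
    have := h.coeff_eq (j := m + 1 + i) (by omega)
    rw [PowerSeries.coeff_coe_mul_mk_eq_sum_acoefZ a h.natDegree_den_le, Fin.sum_univ_castSucc,
      coeff_eq_zero_of_natDegree_lt (p := P) (by have := h.natDegree_num_le; omega)] at this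
    simp only [Fin.val_castSucc, Fin.val_last, Nat.sub_self, h0, zero_mul, add_zero] at this
    rw [Pi.zero_apply, ← this]
    simp only [Matrix.mulVec, dotProduct, Matrix.of_apply]
    refine Finset.sum_congr rfl fun j _ => ?_
    rw [mul_comm]
    congr 2
    push_cast
    ring
  ext k
  rw [coeff_zero]
  rcases lt_or_ge n k with hk | hk
  · exact coeff_eq_zero_of_natDegree_lt (h.natDegree_den_le.trans_lt hk)
  · rcases Nat.eq_zero_or_pos k with rfl | hk'
    · exact h0
    · simpa [Nat.sub_sub_self hk] using congrFun hv ⟨n - k, by omega⟩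

theorem X_mul (h : IsLinearPade a m n P Q) (hP : P.natDegree < m) (hQ : Q.natDegree < n) :
    IsLinearPade a m n (X * P) (X * Q) := by
  refine ⟨natDegree_mul_le.trans (by rw [natDegree_X]; omega),
    natDegree_mul_le.trans (by rw [natDegree_X]; omega), ?_⟩
  convert h.dvd.mul_left PowerSeries.X using 1
  push_cast
  ring

theorem natDegree_eq_or (h : IsLinearPade a m n P Q) (hH : hankelDet a m n ≠ 0)
    (hQ : Q ≠ 0) : P.natDegree = m ∨ Q.natDegree = n := by
  by_contra! hne
  have := (h.X_mul (lt_of_le_of_ne h.natDegree_num_le hne.1)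
    (lt_of_le_of_ne h.natDegree_den_le hne.2)).eq_zero_of_coeff_zero hH (by simp)
  simp [hQ] at this

theorem degree_eq_or (h : IsLinearPade a m n P Q) (hH : hankelDet a m n ≠ 0)
    (hQ : Q ≠ 0) (hm : 0 < m) : P.degree = m ∨ Q.degree = n := by
  refine (h.natDegree_eq_or hH hQ).imp (fun hP => ?_) fun hQ' => ?_
  · exact (degree_eq_iff_natDegree_eq_of_pos hm).2 hP
  · rw [degree_eq_natDegree hQ, hQ']

theorem isCoprime (h : IsLinearPade a m n P Q) (hH : hankelDet a m n ≠ 0)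
    (h0 : Q.coeff 0 ≠ 0) (hm : 0 < m) : IsCoprime P Q := by
  have hQ : Q ≠ 0 := by rintro rfl; simp at h0
  refine isCoprime_of_irreducible_dvd (fun hz => hQ hz.2) ?_
  rintro D hD ⟨P', rfl⟩ ⟨Q', rfl⟩
  rw [mul_coeff_zero] at h0
  have hunit : IsUnit (D : PowerSeries ℂ) := by
    rw [PowerSeries.isUnit_iff_constantCoeff, ← PowerSeries.coeff_zero_eq_constantCoeff_apply,
      Polynomial.coeff_coe]
    exact (left_ne_zero_of_mul h0).isUnit
  have hpos : 0 < D.natDegree := hD.natDegree_pos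
  have hQ' : Q' ≠ 0 := right_ne_zero_of_mul hQ
  have hdQ := natDegree_mul hD.ne_zero hQ'
  have hQn := h.natDegree_den_le
  have hP'm : P'.natDegree < m := by
    rcases eq_or_ne P' 0 with rfl | hP'
    · simpa using hm
    · have := natDegree_mul hD.ne_zero hP'
      have := h.natDegree_num_le
      omega
  have h' : IsLinearPade a m n P' Q' := by
    refine ⟨hP'm.le, by omega, (hunit.dvd_mul_left).1 ?_⟩
    convert h.dvd using 1
    push_cast
    ring
  have := h'.natDegree_eq_or hH hQ'
  omega

end IsLinearPade

/-- The entries of the last row of the determinant defining `Phat`. -/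
def phatRow (a : ℕ → ℂ) (m n : ℕ) (j : Fin (n + 1)) : ℂ[X] :=
  ∑ t ∈ Finset.range (m + 1),
    if (t : ℤ) ≤ (m : ℤ) - n + (j : ℕ) then C (a t) * X ^ (n + t - (j : ℕ)) else 0

theorem coeff_phatRow (a : ℕ → ℂ) (m n : ℕ) (j : Fin (n + 1)) (k : ℕ) :
    (phatRow a m n j).coeff k = if k ≤ m then acoefZ a ((k : ℤ) - n + j) else 0 := by
  have hj := j.is_lt
  have hterm : ∀ t : ℕ, (if (t : ℤ) ≤ (m : ℤ) - n + (j : ℕ) then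
      C (a t) * X ^ (n + t - (j : ℕ)) else 0 : ℂ[X]).coeff k =
      if (t : ℤ) = (k : ℤ) - n + j ∧ k ≤ m then a t else 0 := by
    intro t
    rw [apply_ite (fun p : ℂ[X] => p.coeff k), coeff_C_mul_X_pow, coeff_zero, ← ite_and]
    congr 1
    apply propext
    omega
  rw [phatRow, finsetSum_coeff, Finset.sum_congr rfl fun t _ => hterm t]
  unfold acoefZ
  split_ifs with hk h0
  · rw [Finset.sum_eq_single_of_mem ((k : ℤ) - n + j).toNat]
    · rw [if_pos ⟨by omega, hk⟩]
    · simp only [Finset.mem_range]; omega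
    · intro t _ ht
      rw [if_neg (by omega)]
  · exact Finset.sum_eq_zero fun t _ => if_neg (by omega)
  · exact Finset.sum_eq_zero fun t _ => if_neg (by omega)

theorem coeff_sum_C_mul_X_pow {n : ℕ} (c : Fin (n + 1) → ℂ) (i : Fin (n + 1)) :
    (∑ j : Fin (n + 1), C (c j) * X ^ (n - (j : ℕ)) : ℂ[X]).coeff (n - i) = c i := by
  have hi := i.is_lt
  rw [finsetSum_coeff, Finset.sum_eq_single_of_mem i (Finset.mem_univ _)]
  · simp
  · intro j _ hji
    have hj := j.is_lt
    rw [coeff_C_mul_X_pow, if_neg fun h => hji (Fin.ext (by omega))]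

theorem isLinearPade_of_sum_eq_zero {a : ℕ → ℂ} {m n : ℕ} {c : Fin (n + 1) → ℂ}
    (hc : ∀ i < n, ∑ j, c j * acoefZ a ((m : ℤ) - n + 1 + i + j) = 0) :
    IsLinearPade a m n (∑ j, C (c j) * phatRow a m n j)
      (∑ j : Fin (n + 1), C (c j) * X ^ (n - (j : ℕ))) := by
  have hP : ∀ k, (∑ j, C (c j) * phatRow a m n j).coeff k =
      if k ≤ m then ∑ j, c j * acoefZ a ((k : ℤ) - n + j) else 0 := by
    intro k
    simp only [finsetSum_coeff, coeff_C_mul, coeff_phatRow]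
    split_ifs <;> simp
  have hQ : (∑ j : Fin (n + 1), C (c j) * X ^ (n - (j : ℕ)) : ℂ[X]).natDegree ≤ n :=
    natDegree_sum_le_of_forall_le _ _ fun j _ =>
      (natDegree_C_mul_X_pow_le _ _).trans (Nat.sub_le _ _)
  refine ⟨natDegree_le_iff_coeff_eq_zero.2 fun k hk => by rw [hP, if_neg (by omega)], hQ,
    PowerSeries.X_pow_dvd_iff.2 fun k hk => ?_⟩
  rw [map_sub, Polynomial.coeff_coe, hP, PowerSeries.coeff_coe_mul_mk_eq_sum_acoefZ a hQ]
  simp only [coeff_sum_C_mul_X_pow]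
  split_ifs with hkm
  · exact sub_self _
  · rw [sub_zero, ← hc (k - (m + 1)) (by omega)]
    refine Finset.sum_congr rfl fun j _ => ?_
    rw [Nat.cast_sub (by omega)]
    congr 2
    push_cast
    ring

theorem exists_isLinearPade_of_hankelDet_eq_zero {a : ℕ → ℂ} {m n : ℕ}
    (hH : hankelDet a m n = 0) :
    ∃ P Q : ℂ[X], IsLinearPade a m n P Q ∧ Q ≠ 0 ∧ Q.coeff 0 = 0 := by
  obtain ⟨v, hv, hMv⟩ := Matrix.exists_mulVec_eq_zero_iff.2 hH
  refine ⟨_, _, isLinearPade_of_sum_eq_zero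
    (c := (Fin.snoc v (0 : ℂ) : Fin (n + 1) → ℂ)) fun i hi => ?_, fun h0 => hv ?_, ?_⟩
  · rw [Fin.sum_univ_castSucc]
    simp only [Fin.snoc_castSucc, Fin.snoc_last, zero_mul, add_zero, Fin.val_castSucc]
    have := congrFun hMv ⟨i, hi⟩
    simp only [Matrix.mulVec, dotProduct, Matrix.of_apply, Pi.zero_apply] at this
    simpa only [mul_comm] using this
  · ext j
    have := coeff_sum_C_mul_X_pow (Fin.snoc v (0 : ℂ) : Fin (n + 1) → ℂ) j.castSucc
    rw [h0, Fin.snoc_castSucc] at this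
    simpa using this.symm
  · simpa using coeff_sum_C_mul_X_pow (Fin.snoc v (0 : ℂ) : Fin (n + 1) → ℂ) (Fin.last n)

/-- Signed maximal minors of the first `n` rows of the Jacobi determinants. -/
def jacobiCofactor (a : ℕ → ℂ) (m n : ℕ) (j : Fin (n + 1)) : ℂ :=
  (-1) ^ (n + j : ℕ) * Matrix.det (Matrix.of fun i k : Fin n =>
    acoefZ a ((m : ℤ) - n + 1 + i + (j.succAbove k : Fin (n + 1))))

theorem jacobiCofactor_last (a : ℕ → ℂ) (m n : ℕ) :
    jacobiCofactor a m n (Fin.last n) = hankelDet a m n := by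
  simp [jacobiCofactor, hankelDet]

theorem det_eq_sum_jacobiCofactor {R : Type*} [CommRing R] (f : ℂ →+* R) (a : ℕ → ℂ) (m n : ℕ)
    (r : Fin (n + 1) → R) :
    Matrix.det (Matrix.of fun i j : Fin (n + 1) =>
      if (i : ℕ) < n then f (acoefZ a ((m : ℤ) - n + 1 + i + j)) else r j) =
      ∑ j, f (jacobiCofactor a m n j) * r j := by
  rw [Matrix.det_succ_row _ (Fin.last n)]
  refine Finset.sum_congr rfl fun j _ => ?_
  rw [jacobiCofactor, map_mul, RingHom.map_det]
  simp only [Matrix.of_apply, Fin.val_last, lt_irrefl, if_false, map_pow, map_neg, map_one]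
  rw [mul_right_comm]
  congr 3
  ext i k
  simp

theorem sum_jacobiCofactor_mul (a : ℕ → ℂ) (m : ℕ) {n i : ℕ} (hi : i < n) :
    ∑ j, jacobiCofactor a m n j * acoefZ a ((m : ℤ) - n + 1 + i + j) = 0 := by
  have h := det_eq_sum_jacobiCofactor (RingHom.id ℂ) a m n
    fun j => acoefZ a ((m : ℤ) - n + 1 + i + j)
  simp only [RingHom.id_apply] at h
  rw [← h]
  refine Matrix.det_zero_of_row_eq (i := ⟨i, by omega⟩) (j := Fin.last n)
    (fun h => by simp [Fin.ext_iff] at h; omega) ?_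
  ext j
  simp [hi]

theorem Qhat_eq_sum (a : ℕ → ℂ) (m n : ℕ) :
    Qhat a m n = ∑ j : Fin (n + 1), C (jacobiCofactor a m n j) * X ^ (n - (j : ℕ)) :=
  det_eq_sum_jacobiCofactor C a m n _

theorem Phat_eq_sum (a : ℕ → ℂ) (m n : ℕ) :
    Phat a m n = ∑ j, C (jacobiCofactor a m n j) * phatRow a m n j :=
  det_eq_sum_jacobiCofactor C a m n _

theorem isLinearPade_Phat_Qhat (a : ℕ → ℂ) (m n : ℕ) :
    IsLinearPade a m n (Phat a m n) (Qhat a m n) := by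
  rw [Phat_eq_sum, Qhat_eq_sum]
  exact isLinearPade_of_sum_eq_zero fun i hi => sum_jacobiCofactor_mul a m hi

theorem coeff_zero_Qhat (a : ℕ → ℂ) (m n : ℕ) : (Qhat a m n).coeff 0 = hankelDet a m n := by
  rw [Qhat_eq_sum, ← jacobiCofactor_last]
  simpa using coeff_sum_C_mul_X_pow (jacobiCofactor a m n) (Fin.last n)

theorem not_isCoprime_of_hankelDet_eq_zero {a : ℕ → ℂ} {m n : ℕ} (hH : hankelDet a m n = 0) :
    ¬ IsCoprime (Phat a m n) (Qhat a m n) := by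
  intro hc
  have hQ : (Qhat a m n).coeff 0 = 0 := (coeff_zero_Qhat a m n).trans hH
  have hP : (Phat a m n).coeff 0 = 0 := by
    rw [← (isLinearPade_Phat_Qhat a m n).coeff_eq (Nat.zero_le _), PowerSeries.coeff_coe_mul_mk]
    simp [hQ]
  exact not_isUnit_X (hc.isUnit_of_dvd' (X_dvd_iff.2 hP) (X_dvd_iff.2 hQ))

theorem hankelDet_ne_zero_of_isPade {a : ℕ → ℂ} {m n : ℕ} {P Q : ℂ[X]} (h : IsPade a m n P Q)
    (hd : P.degree = m ∨ Q.degree = n) : hankelDet a m n ≠ 0 := by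
  intro hH
  obtain ⟨P₁, Q₁, h₁, hQ₁, h0⟩ := exists_isLinearPade_of_hankelDet_eq_zero hH
  obtain ⟨T, rfl, rfl⟩ := h₁.exists_eq_mul h
  rw [mul_coeff_zero, h.2.2.2.1, mul_one] at h0
  have hT : T ≠ 0 := left_ne_zero_of_mul hQ₁
  have hTd : 0 < T.natDegree := by
    rw [Nat.pos_iff_ne_zero]
    intro hT0
    rw [eq_C_of_natDegree_eq_zero hT0, h0, C_0] at hT
    exact hT rfl
  rcases hd with hd | hd
  · have hP : P ≠ 0 := by rintro rfl; simp at hd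
    have := natDegree_mul hT hP
    have := natDegree_eq_of_degree_eq_some hd
    have := h₁.natDegree_num_le
    omega
  · have := natDegree_mul hT (right_ne_zero_of_mul hQ₁)
    have := natDegree_eq_of_degree_eq_some hd
    have := h₁.natDegree_den_le
    omega

/-- Proposition 2.2 : equivalence of (i) `C_{m,n} ≠ 0`; (ii) the Padé approximant
`[S; m/n] = P_m/Q_n` exists with `deg P_m = m` or `deg Q_n = n`; (iii) `P̂_m, Q̂_n`
coprime and `deg P̂_m = m` or `deg Q̂_n = n`; (iv) `P̂_m, Q̂_n` coprime; together with
the relations between `(P̂_m, Q̂_n)` and `(P_m, Q_n)`. -/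
theorem stmt_0 (a : ℕ → ℂ) (m n : ℕ) (hm : 0 < m) (hn : 0 < n) :
    ((hankelDet a m n ≠ 0) ↔
      (∃ P Q : Polynomial ℂ, IsPade a m n P Q ∧
        (P.degree = (m : WithBot ℕ) ∨ Q.degree = (n : WithBot ℕ)))) ∧
    ((hankelDet a m n ≠ 0) ↔
      (IsCoprime (Phat a m n) (Qhat a m n) ∧
        ((Phat a m n).degree = (m : WithBot ℕ) ∨ (Qhat a m n).degree = (n : WithBot ℕ)))) ∧
    ((hankelDet a m n ≠ 0) ↔ IsCoprime (Phat a m n) (Qhat a m n)) ∧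
    (hankelDet a m n ≠ 0 → ∀ P Q : Polynomial ℂ, IsPade a m n P Q →
      Phat a m n = Polynomial.C ((Qhat a m n).eval 0) * P ∧
      Qhat a m n = Polynomial.C ((Qhat a m n).eval 0) * Q) ∧
    (hankelDet a m n = 0 → ∀ P Q : Polynomial ℂ, IsPade a m n P Q →
      ∃ T : Polynomial ℂ, T.eval 0 = 0 ∧
        Phat a m n = T * P ∧ Qhat a m n = T * Q) := by
  have hlin := isLinearPade_Phat_Qhat a m n
  have hcoeff := coeff_zero_Qhat a m n
  have hcop : hankelDet a m n ≠ 0 → IsCoprime (Phat a m n) (Qhat a m n) := fun hH =>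
    hlin.isCoprime hH (by rwa [hcoeff]) hm
  have hne : hankelDet a m n ≠ 0 → Qhat a m n ≠ 0 := fun hH h => hH (by rw [← hcoeff, h, coeff_zero])
  have hcop' : IsCoprime (Phat a m n) (Qhat a m n) → hankelDet a m n ≠ 0 := fun hc hH =>
    not_isCoprime_of_hankelDet_eq_zero hH hc
  refine ⟨⟨fun hH => ?_, fun ⟨P, Q, h, hd⟩ => hankelDet_ne_zero_of_isPade h hd⟩,
    ⟨fun hH => ⟨hcop hH, hlin.degree_eq_or hH (hne hH) hm⟩, fun h => hcop' h.1⟩,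
    ⟨hcop, hcop'⟩, fun hH P Q h => ?_, fun hH P Q h => ?_⟩
  · have h' := hlin.C_mul (hankelDet a m n)⁻¹
    have h0 : (C (hankelDet a m n)⁻¹ * Qhat a m n).coeff 0 = 1 := by
      rw [coeff_C_mul, hcoeff, inv_mul_cancel₀ hH]
    refine ⟨_, _, h'.isPade (h'.isCoprime hH (by simp [h0]) hm) h0,
      h'.degree_eq_or hH (fun h => by simp [h] at h0) hm⟩
  · obtain ⟨T, hP, hQ⟩ := hlin.exists_eq_mul h
    have hT : IsUnit T := (hcop hH).isUnit_of_dvd' ⟨P, hP⟩ ⟨Q, hQ⟩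
    obtain ⟨c, -, rfl⟩ := Polynomial.isUnit_iff.1 hT
    have : (Qhat a m n).eval 0 = c := by
      rw [← coeff_zero_eq_eval_zero, hQ, mul_coeff_zero, h.2.2.2.1, coeff_C_zero, mul_one]
    rw [this]
    exact ⟨hP, hQ⟩
  · obtain ⟨T, hP, hQ⟩ := hlin.exists_eq_mul h
    refine ⟨T, ?_, hP, hQ⟩
    rw [hQ, mul_coeff_zero, h.2.2.2.1, mul_one] at hcoeff
    rw [← coeff_zero_eq_eval_zero, hcoeff, hH]

end
end

section
/- For any positive integers m,n, the set 𝒟_{m,n} of formal power series whose Hankel determinant C_{m,n} is nonzero, and the set 𝒩_{m,n} of series in 𝒟_{m,n} whose Padé denominator Q_{m,n} has exact degree n, are open and dense subsets both of the space 𝔽 of formal power series over ℂ endowed with the product topology, and of the space H(Ω) of holomorphic functions on a simply connected domain Ω ⊂ ℂ containing 0, endowed with the topology of locally uniform convergence. -/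
open Polynomial Filter Finset Metric Topology

noncomputable section

section Algebra

/-- Coefficients of the product of `∑ a_k z^k` with a polynomial of degree `< n`. -/
lemma coeff_coe_mul_mk (a : ℕ → ℂ) {n : ℕ} {R : ℂ[X]} (hR : R.degree < n) (k : ℕ) :
    PowerSeries.coeff k ((R : PowerSeries ℂ) * PowerSeries.mk a) =
      ∑ i ∈ range n, R.coeff i * acoefZ a ((k : ℤ) - i) := by
  rw [PowerSeries.coeff_mul, Finset.Nat.sum_antidiagonal_eq_sum_range_succ_mk]
  have h1 : ∀ i ∈ range (k + 1), (R.coeff i * a (k - i)) = R.coeff i * acoefZ a ((k : ℤ) - i) := by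
    intro i hi
    have hi' : i ≤ k := by simpa [Nat.lt_succ_iff] using hi
    rw [acoefZ, if_pos (by omega), show ((k : ℤ) - i).toNat = k - i by omega]
  simp only [Polynomial.coeff_coe, PowerSeries.coeff_mk]
  rw [Finset.sum_congr rfl h1]
  trans ∑ i ∈ range (k + 1 + n), R.coeff i * acoefZ a ((k : ℤ) - i)
  · refine Finset.sum_subset (by simp) fun i _ hi => ?_
    rw [acoefZ, if_neg (by simp at hi; omega), mul_zero]
  · refine (Finset.sum_subset (by simp) fun i _ hi => ?_).symm
    rw [Polynomial.coeff_eq_zero_of_degree_lt, zero_mul]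
    exact hR.trans_le (by simpa using hi)

/-- The matrix whose determinant is `hankelDet a m n`. -/
def hankelMatrix (a : ℕ → ℂ) (m n : ℕ) : Matrix (Fin n) (Fin n) ℂ :=
  Matrix.of fun i j : Fin n => acoefZ a ((m : ℤ) - n + 1 + i + j)

lemma hankelMatrix_mulVec (a : ℕ → ℂ) (m : ℕ) {n : ℕ} {R : ℂ[X]} (hR : R.degree < n) (r : Fin n) :
    (hankelMatrix a m n).mulVec (fun s => R.coeff (n - 1 - s)) r =
      PowerSeries.coeff (m + r) ((R : PowerSeries ℂ) * PowerSeries.mk a) := by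
  rw [coeff_coe_mul_mk a hR, ← Finset.sum_range_reflect, ← Fin.sum_univ_eq_sum_range
    (fun s : ℕ => R.coeff (n - 1 - s) * acoefZ a (((m + r : ℕ) : ℤ) - (n - 1 - s : ℕ))) n, Matrix.mulVec,
    dotProduct]
  refine Finset.sum_congr rfl fun s _ => ?_
  have := s.2
  rw [mul_comm, hankelMatrix, Matrix.of_apply]
  congr 2
  omega

lemma exists_poly_coeff_rev {n : ℕ} (v : Fin n → ℂ) :
    ∃ R : ℂ[X], R.degree < n ∧ (fun s : Fin n => R.coeff (n - 1 - s)) = v := by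
  refine ⟨((degreeLTEquiv ℂ n).symm (v ∘ Fin.rev)).1,
    mem_degreeLT.1 ((degreeLTEquiv ℂ n).symm (v ∘ Fin.rev)).2, ?_⟩
  funext s
  have h := congrFun ((degreeLTEquiv ℂ n).apply_symm_apply (v ∘ Fin.rev)) s.rev
  simp only [Function.comp_apply, Fin.rev_rev] at h
  rw [← h]
  simp only [degreeLTEquiv, Fin.val_rev, LinearEquiv.coe_mk, LinearMap.coe_mk, AddHom.coe_mk]
  congr 1
  omega

lemma eq_zero_of_hankelDet_ne_zero {a : ℕ → ℂ} {m n : ℕ} (h : hankelDet a m n ≠ 0) {R : ℂ[X]}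
    (hR : R.degree < n)
    (hRa : ∀ r < n, PowerSeries.coeff (m + r) ((R : PowerSeries ℂ) * PowerSeries.mk a) = 0) :
    R = 0 := by
  have hv : (fun s : Fin n => R.coeff (n - 1 - s)) = 0 :=
    Matrix.eq_zero_of_mulVec_eq_zero (M := hankelMatrix a m n) h
      (funext fun r => by rw [hankelMatrix_mulVec a m hR]; exact hRa r r.2)
  ext i
  by_cases hi : i < n
  · have := congrFun hv ⟨n - 1 - i, by omega⟩
    simpa [show n - 1 - (n - 1 - i) = i by omega] using this
  · rw [coeff_zero, coeff_eq_zero_of_degree_lt]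
    exact hR.trans_le (by simpa using hi)

lemma exists_ne_zero_of_hankelDet_eq_zero {a : ℕ → ℂ} {m n : ℕ} (h : hankelDet a m n = 0) :
    ∃ R : ℂ[X], R ≠ 0 ∧ R.degree < n ∧
      ∀ r < n, PowerSeries.coeff (m + r) ((R : PowerSeries ℂ) * PowerSeries.mk a) = 0 := by
  obtain ⟨v, hv0, hv⟩ := Matrix.exists_mulVec_eq_zero_iff (M := hankelMatrix a m n) |>.2 h
  obtain ⟨R, hR, rfl⟩ := exists_poly_coeff_rev v
  refine ⟨R, ?_, hR, fun r hr => ?_⟩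
  · rintro rfl
    exact hv0 (by ext; simp)
  · rw [← hankelMatrix_mulVec a m hR ⟨r, hr⟩, hv, Pi.zero_apply]

lemma exists_of_hankelDet_ne_zero {a : ℕ → ℂ} {m n : ℕ} (h : hankelDet a m n ≠ 0) (w : ℕ → ℂ) :
    ∃ R : ℂ[X], R.degree < n ∧
      ∀ r < n, PowerSeries.coeff (m + r) ((R : PowerSeries ℂ) * PowerSeries.mk a) = w r := by
  have hu : IsUnit (hankelMatrix a m n) :=
    (Matrix.isUnit_iff_isUnit_det _).2 (isUnit_iff_ne_zero.2 h)
  obtain ⟨v, hv⟩ := Matrix.mulVec_surjective_iff_isUnit.2 hu fun r => w r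
  obtain ⟨R, hR, rfl⟩ := exists_poly_coeff_rev v
  exact ⟨R, hR, fun r hr => by rw [← hankelMatrix_mulVec a m hR ⟨r, hr⟩, hv]⟩

lemma isPade_coeff_iff {a : ℕ → ℂ} {P Q : ℂ[X]} (j : ℕ) :
    (∑ i ∈ Finset.range (j + 1), Q.coeff i * a (j - i)) = P.coeff j ↔
      PowerSeries.coeff j ((Q : PowerSeries ℂ) * PowerSeries.mk a) = P.coeff j := by
  rw [PowerSeries.coeff_mul, Finset.Nat.sum_antidiagonal_eq_sum_range_succ_mk]
  simp

lemma hankelDet_succ_ne_zero_of_isPade {a : ℕ → ℂ} {m n : ℕ} (h : hankelDet a m n ≠ 0)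
    {P Q : ℂ[X]} (hPQ : IsPade a m n P Q) (hQ : Q.degree = n) : hankelDet a (m + 1) n ≠ 0 := by
  obtain ⟨hP, -, -, hQ0, hj⟩ := hPQ
  intro h0
  obtain ⟨R, hR0, hR, hRa⟩ := exists_ne_zero_of_hankelDet_eq_zero h0
  have hcoeff : (R - C (R.coeff 0) * Q).coeff 0 = 0 := by simp [hQ0]
  obtain ⟨U, hU⟩ := X_dvd_iff.2 hcoeff
  have hUdeg : U.degree < n := by
    rcases eq_or_ne U 0 with rfl | hU0
    · simp
    have hle : (R - C (R.coeff 0) * Q).degree ≤ n := by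
      refine (degree_sub_le _ _).trans (max_le hR.le ?_)
      rw [← smul_eq_C_mul]
      exact (degree_smul_le _ _).trans hQ.le
    rw [hU, mul_comm, degree_mul_X, degree_eq_natDegree hU0] at hle
    rw [degree_eq_natDegree hU0]
    norm_cast at hle ⊢
  have hU0 : U = 0 := by
    refine eq_zero_of_hankelDet_ne_zero h hUdeg fun r hr => ?_
    have hPc : P.coeff (m + 1 + r) = 0 := coeff_eq_zero_of_natDegree_lt (by omega)
    have hQc := (isPade_coeff_iff (m + 1 + r)).1 (hj (m + 1 + r) (by omega))
    rw [hPc] at hQc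
    rw [← PowerSeries.coeff_succ_X_mul, ← mul_assoc, ← Polynomial.coe_X, ← Polynomial.coe_mul,
      ← hU, show m + r + 1 = m + 1 + r by omega, Polynomial.coe_sub, Polynomial.coe_mul, sub_mul,
      map_sub, hRa r hr, Polynomial.coe_C, mul_assoc, PowerSeries.coeff_C_mul, hQc]
    simp
  rw [hU0, mul_zero, sub_eq_zero] at hU
  have hc : R.coeff 0 ≠ 0 := fun hc => hR0 (by rw [hU, hc]; simp)
  rw [hU, degree_C_mul hc, hQ] at hR
  exact hR.false

lemma exists_isPade {a : ℕ → ℂ} {m n : ℕ} (h : hankelDet a m n ≠ 0)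
    (h' : hankelDet a (m + 1) n ≠ 0) :
    ∃ P Q : ℂ[X], IsPade a m n P Q ∧ Q.degree = (n : WithBot ℕ) := by
  obtain ⟨R, hR, hRa⟩ := exists_of_hankelDet_ne_zero h fun r => -a (m + 1 + r)
  set Q : ℂ[X] := 1 + X * R with hQdef
  set P : ℂ[X] := PowerSeries.trunc (m + 1) ((Q : PowerSeries ℂ) * PowerSeries.mk a) with hPdef
  have hQ0 : Q.coeff 0 = 1 := by simp [hQdef]
  have hQne : Q ≠ 0 := fun hQ => by simp [hQ] at hQ0
  have hQvan : ∀ r < n,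
      PowerSeries.coeff (m + 1 + r) ((Q : PowerSeries ℂ) * PowerSeries.mk a) = 0 := by
    intro r hr
    rw [hQdef, Polynomial.coe_add, Polynomial.coe_one, Polynomial.coe_mul, Polynomial.coe_X,
      add_mul, one_mul, mul_assoc, map_add, show m + 1 + r = m + r + 1 by omega,
      PowerSeries.coeff_succ_X_mul, hRa r hr, PowerSeries.coeff_mk,
      show m + 1 + r = m + r + 1 by omega, add_neg_cancel]
  have hQle : Q.natDegree ≤ n := by
    rcases eq_or_ne R 0 with rfl | hR0
    · simp [hQdef]
    have : R.natDegree < n := (natDegree_lt_iff_degree_lt hR0).2 hR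
    refine (natDegree_add_le _ _).trans (max_le (by simp) (natDegree_mul_le.trans ?_))
    rw [natDegree_X]
    omega
  have hQdeg : Q.degree = n := by
    refine le_antisymm (natDegree_le_iff_degree_le.1 hQle) (not_lt.1 fun hlt => ?_)
    exact hQne (eq_zero_of_hankelDet_ne_zero h' hlt hQvan)
  have hPle : P.natDegree ≤ m := Nat.lt_succ_iff.1 (PowerSeries.natDegree_trunc_lt _ m)
  have hj : ∀ j ≤ m + n,
      PowerSeries.coeff j ((Q : PowerSeries ℂ) * PowerSeries.mk a) = P.coeff j := by
    intro j hj
    rw [hPdef, PowerSeries.coeff_trunc]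
    split_ifs with hjm
    · rfl
    · obtain ⟨r, rfl⟩ := Nat.exists_eq_add_of_le (not_lt.1 hjm)
      exact hQvan r (by omega)
  refine ⟨P, Q, ⟨hPle, hQle, ?_, hQ0, fun j hjm => (isPade_coeff_iff j).2 (hj j hjm)⟩, hQdeg⟩
  refine isCoprime_of_dvd P Q (fun hPQ => hQne hPQ.2) ?_
  rintro D hDu hD0 ⟨P', hP'⟩ ⟨Q', hQ'⟩
  have hDc : IsUnit (D : PowerSeries ℂ) := by
    rw [PowerSeries.isUnit_iff_constantCoeff, isUnit_iff_ne_zero]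
    intro hD
    rw [Polynomial.constantCoeff_coe] at hD
    rw [hQ', mul_coeff_zero, hD, zero_mul] at hQ0
    exact zero_ne_one hQ0
  have hQ'ne : Q' ≠ 0 := by
    rintro rfl
    exact hQne (by rw [hQ', mul_zero])
  have hdvd : (PowerSeries.X : PowerSeries ℂ) ^ (m + n + 1) ∣
      (Q' : PowerSeries ℂ) * PowerSeries.mk a - (P' : PowerSeries ℂ) := by
    refine (hDc.dvd_mul_left).1 ?_
    rw [mul_sub, ← mul_assoc, ← Polynomial.coe_mul, ← Polynomial.coe_mul, ← hQ', ← hP',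
      PowerSeries.X_pow_dvd_iff]
    intro j hjm
    rw [map_sub, hj j (by omega), Polynomial.coeff_coe, sub_self]
  rw [PowerSeries.X_pow_dvd_iff] at hdvd
  have hP'le : P'.natDegree ≤ m := by
    rcases eq_or_ne P' 0 with rfl | hP0
    · simp
    rw [hP', natDegree_mul hD0 hP0] at hPle
    omega
  have hQ'deg : Q'.degree < n := by
    have hDpos : 0 < D.natDegree :=
      natDegree_pos_iff_degree_pos.2 (degree_pos_of_ne_zero_of_nonunit hD0 hDu)
    rw [hQ', natDegree_mul hD0 hQ'ne] at hQle
    rw [← natDegree_lt_iff_degree_lt hQ'ne]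
    omega
  refine hQ'ne (eq_zero_of_hankelDet_ne_zero h' hQ'deg fun r hr => ?_)
  have := hdvd (m + 1 + r) (by omega)
  rwa [map_sub, Polynomial.coeff_coe, coeff_eq_zero_of_natDegree_lt (by omega), sub_zero] at this

lemma Nset_eq_inter (m n : ℕ) : Nset m n = Dset m n ∩ Dset (m + 1) n := by
  ext a
  constructor
  · rintro ⟨h, P, Q, hPQ, hQ⟩
    exact ⟨h, hankelDet_succ_ne_zero_of_isPade h hPQ hQ⟩
  · rintro ⟨h, h'⟩
    exact ⟨h, exists_isPade h h'⟩

/-- Moving the coefficient of index `m` adds a multiple of the exchange matrix to the Hankel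
matrix, so that the determinant is, up to sign, a characteristic polynomial. -/
lemma eventually_add_single_mem_Dset (a : ℕ → ℂ) (m n : ℕ) :
    ∀ᶠ t in 𝓝[≠] (0 : ℂ), a + Pi.single m t ∈ Dset m n := by
  set A : Matrix (Fin n) (Fin n) ℂ := (hankelMatrix a m n).submatrix id Fin.revPerm
  have hdet : ∀ t, ((Equiv.Perm.sign (Fin.revPerm (n := n)) : ℤ) : ℂ) *
      hankelDet (a + Pi.single m t) m n = (-A).charpoly.eval t := by
    intro t
    rw [Matrix.eval_charpoly, sub_neg_eq_add]
    refine (Matrix.det_permute' Fin.revPerm (hankelMatrix (a + Pi.single m t) m n)).symm.trans ?_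
    congr 1
    ext i j
    have hi := i.2
    have hj := j.2
    simp only [A, hankelMatrix, Matrix.submatrix_apply, Matrix.of_apply, Matrix.add_apply, id,
      Matrix.scalar_apply, Matrix.diagonal_apply, Fin.revPerm_apply, Fin.val_rev, acoefZ]
    by_cases hij : i = j
    · subst hij
      have he : (m : ℤ) - n + 1 + i + (n - (i + 1) : ℕ) = m := by omega
      simp only [he]
      simp [add_comm]
    · have hne : (i : ℕ) ≠ j := fun h => hij (Fin.ext h)
      split_ifs with h0
      · have hk : ((m : ℤ) - n + 1 + i + (n - (j + 1) : ℕ)).toNat ≠ m := by omega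
        rw [Pi.add_apply, Pi.single_eq_of_ne hk, add_zero, zero_add]
      · simp
  have hfin : ((-A).charpoly.roots.toFinset : Set ℂ).Finite := Finset.finite_toSet _
  have hev : ∀ᶠ t in 𝓝[≠] (0 : ℂ), t ∉ ((-A).charpoly.roots.toFinset : Set ℂ) := by
    have := (hfin.subset (Set.sdiff_subset (t := {0}))).isClosed.isOpen_compl.mem_nhds
      (show (0 : ℂ) ∈ (((-A).charpoly.roots.toFinset : Set ℂ) \ {0})ᶜ by simp)
    filter_upwards [mem_nhdsWithin_of_mem_nhds this, self_mem_nhdsWithin] with t ht ht0 hmem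
    exact ht ⟨hmem, ht0⟩
  filter_upwards [hev] with t ht h0
  refine ht ?_
  have hroot : (-A).charpoly.eval t = 0 := by rw [← hdet t, h0, mul_zero]
  simpa [mem_roots (Matrix.charpoly_monic _).ne_zero] using hroot

end Algebra

section Topology

lemma isOpen_Dset (m n : ℕ) : IsOpen (Dset m n) := by
  refine isOpen_ne_fun (Continuous.matrix_det (continuous_matrix fun i j => ?_)) continuous_const
  simp only [Matrix.of_apply, acoefZ]
  split_ifs
  · exact continuous_apply _
  · exact continuous_const

lemma dense_preimage_Dset {E : Type*} [TopologicalSpace E] {φ : E → ℕ → ℂ} {m : ℕ}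
    (γ : E → ℂ → E) (hγ : ∀ x, Continuous (γ x)) (hγ0 : ∀ x, γ x 0 = x)
    (hφ : ∀ x t, φ (γ x t) = φ x + Pi.single m t) (n : ℕ) : Dense (φ ⁻¹' Dset m n) := by
  intro x
  have ht : Tendsto (γ x) (𝓝[≠] 0) (𝓝 x) := by
    have := (hγ x).tendsto 0
    rw [hγ0] at this
    exact this.mono_left nhdsWithin_le_nhds
  refine mem_closure_of_tendsto ht ?_
  filter_upwards [eventually_add_single_mem_Dset (φ x) m n] with t h
  rwa [Set.mem_preimage, hφ]

lemma isOpen_dense_of_perturbation {E : Type*} [TopologicalSpace E] {φ : E → ℕ → ℂ}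
    (hφc : Continuous φ) (γ : ℕ → E → ℂ → E) (hγ : ∀ k x, Continuous (γ k x))
    (hγ0 : ∀ k x, γ k x 0 = x) (hφ : ∀ k x t, φ (γ k x t) = φ x + Pi.single k t) (m n : ℕ) :
    (IsOpen (φ ⁻¹' Dset m n) ∧ Dense (φ ⁻¹' Dset m n)) ∧
      (IsOpen (φ ⁻¹' Nset m n) ∧ Dense (φ ⁻¹' Nset m n)) := by
  have ho : ∀ k, IsOpen (φ ⁻¹' Dset k n) := fun k => (isOpen_Dset k n).preimage hφc
  have hd : ∀ k, Dense (φ ⁻¹' Dset k n) := fun k =>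
    dense_preimage_Dset (γ k) (hγ k) (hγ0 k) (hφ k) n
  rw [Nset_eq_inter, Set.preimage_inter]
  exact ⟨⟨ho m, hd m⟩, (ho m).inter (ho (m + 1)), (hd m).inter_of_isOpen_left (hd (m + 1)) (ho m)⟩

end Topology

section Holomorphic

lemma tendstoLocallyUniformlyOn_nhds {Ω : Set ℂ} (hΩ : IsOpen Ω) (f : Hol Ω) :
    TendstoLocallyUniformlyOn (fun g : Hol Ω => g.1) f.1 (𝓝 f) Ω := by
  rw [tendstoLocallyUniformlyOn_iff_forall_isCompact hΩ]
  intro K hKΩ hK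
  have hc : Tendsto (fun g : Hol Ω =>
      UniformOnFun.ofFun {K : Set Ω | IsCompact K} fun z : Ω => g.1 z) (𝓝 f)
      (𝓝 (UniformOnFun.ofFun {K : Set Ω | IsCompact K} fun z : Ω => f.1 z)) :=
    continuous_induced_dom.tendsto f
  have hK' : IsCompact ((↑) ⁻¹' K : Set Ω) := by
    rw [Topology.IsInducing.subtypeVal.isCompact_iff, Subtype.image_preimage_coe,
      Set.inter_eq_right.2 hKΩ]
    exact hK
  have h := (UniformOnFun.tendsto_iff_tendstoUniformlyOn.1 hc) _ hK'
  intro u hu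
  filter_upwards [h u hu] with g hg z hz
  exact hg ⟨z, hKΩ hz⟩ hz

lemma TendstoLocallyUniformlyOn.iterate_deriv {ι : Type*} {φ : Filter ι} {F : ι → ℂ → ℂ}
    {f : ℂ → ℂ} {U : Set ℂ} (hU : IsOpen U) (hf : TendstoLocallyUniformlyOn F f φ U)
    (hF : ∀ᶠ i in φ, DifferentiableOn ℂ (F i) U) (k : ℕ) :
    TendstoLocallyUniformlyOn (fun i => iteratedDeriv k (F i)) (iteratedDeriv k f) φ U := by
  suffices TendstoLocallyUniformlyOn (fun i => iteratedDeriv k (F i)) (iteratedDeriv k f) φ U ∧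
      ∀ᶠ i in φ, DifferentiableOn ℂ (iteratedDeriv k (F i)) U from this.1
  induction k with
  | zero => simpa only [iteratedDeriv_zero] using ⟨hf, hF⟩
  | succ k ih =>
    simp only [iteratedDeriv_succ]
    exact ⟨ih.1.deriv ih.2 hU, ih.2.mono fun i hi => hi.deriv hU⟩

lemma continuous_tc {Ω : Set ℂ} (hΩ : IsOpen Ω) (h0 : (0 : ℂ) ∈ Ω) :
    Continuous fun f : Hol Ω => tc f.1 := by
  refine continuous_pi fun k => continuous_iff_continuousAt.2 fun f => ?_
  exact (((tendstoLocallyUniformlyOn_nhds hΩ f).iterate_deriv hΩ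
    (Eventually.of_forall fun g => g.2.1) k).tendsto_at h0).div_const _

/-- The monomial `z ^ k` as an element of `H(Ω)`. -/
def holMonomial (Ω : Set ℂ) (k : ℕ) : Hol Ω :=
  ⟨Ω.indicator fun z => z ^ k,
    (differentiable_pow k).differentiableOn.congr fun _ hz => Set.indicator_of_mem hz _,
    fun _ hz => Set.indicator_of_notMem hz _⟩

lemma continuous_add_smul {Ω : Set ℂ} (f g : Hol Ω) : Continuous fun t : ℂ => f + t • g := by
  have hf : Continuous fun z : Ω => f.1 z := f.2.1.continuousOn.domRestrict
  have hg : Continuous fun z : Ω => g.1 z := g.2.1.continuousOn.domRestrict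
  let F : C(ℂ × Ω, ℂ) := ⟨fun p => f.1 p.2 + p.1 * g.1 p.2,
    (hf.comp continuous_snd).add (continuous_fst.mul (hg.comp continuous_snd))⟩
  exact continuous_induced_rng.2
    (ContinuousMap.isUniformEmbedding_toUniformOnFunIsCompact.uniformContinuous.continuous.comp
      F.curry.continuous)

lemma tc_add_smul_holMonomial {Ω : Set ℂ} (hΩ : IsOpen Ω) (h0 : (0 : ℂ) ∈ Ω) (k : ℕ) (f : Hol Ω)
    (t : ℂ) : tc (f + t • holMonomial Ω k).1 = tc f.1 + Pi.single k t := by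
  funext j
  have hf : ContDiffAt ℂ j f.1 0 := (f.2.1.analyticAt (hΩ.mem_nhds h0)).contDiffAt
  have heq : (f + t • holMonomial Ω k).1 =ᶠ[𝓝 0] fun z => f.1 z + t * z ^ k := by
    filter_upwards [hΩ.mem_nhds h0] with z hz
    simp [holMonomial, hz]
  have hj : (j.factorial : ℂ) ≠ 0 := mod_cast j.factorial_ne_zero
  rw [tc, heq.iteratedDeriv_eq, iteratedDeriv_fun_add hf (by fun_prop),
    iteratedDeriv_const_mul_field, iteratedDeriv_fun_pow_zero, Pi.add_apply, tc, Pi.single_apply,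
    add_div]
  split_ifs with h
  · subst h
    rw [mul_div_cancel_right₀ _ hj]
  · simp

end Holomorphic

/-- Proposition 2.4 : the sets `𝒟_{m,n}` and `𝒩_{m,n}` are open and dense, both in the
space `𝔽 = ℂ^ℕ` of formal power series with the product topology, and in `H(Ω)` for a
simply connected domain `Ω ∋ 0`, with the topology of locally uniform convergence. -/
theorem stmt_1 (m n : ℕ) (hm : 0 < m) (hn : 0 < n)
    (Ω : Set ℂ) (hΩo : IsOpen Ω) (hΩ0 : (0 : ℂ) ∈ Ω) (hΩc : IsConnected Ω)
    (hΩsc : SimplyConnectedSpace Ω) :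
    (IsOpen (Dset m n) ∧ Dense (Dset m n)) ∧
    (IsOpen (Nset m n) ∧ Dense (Nset m n)) ∧
    (IsOpen {f : Hol Ω | tc f.1 ∈ Dset m n} ∧ Dense {f : Hol Ω | tc f.1 ∈ Dset m n}) ∧
    (IsOpen {f : Hol Ω | tc f.1 ∈ Nset m n} ∧ Dense {f : Hol Ω | tc f.1 ∈ Nset m n}) := by
  have hF := isOpen_dense_of_perturbation (φ := fun a : ℕ → ℂ => a) continuous_id
    (fun k a t => a + Pi.single k t)
    (fun k a => continuous_const.add (continuous_single (A := fun _ : ℕ => ℂ) k)) (by simp) (fun _ _ _ => rfl) m n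
  have hH := isOpen_dense_of_perturbation (continuous_tc hΩo hΩ0)
    (fun k f t => f + t • holMonomial Ω k) (fun k f => continuous_add_smul f _) (by simp)
    (tc_add_smul_holMonomial hΩo hΩ0) m n
  exact ⟨hF.1, hF.2, hH⟩

end
end

section
/- Let 𝒮=(m_k,n_k)_{k≥0} be a sequence of pairs of positive integers such that the sequence (m_k+n_k)_{k≥0} is unbounded. Then the set 𝔽^𝒵_𝒮 of formal power series f such that f ∈ 𝒩_{m_k,n_k} for all k ≥ 0 and the set consisting of the zeros of all the Padé approximants [f; m_k/n_k], k ≥ 0, is dense in ℂ, is a dense G_δ subset of the space 𝔽 of formal power series with the product topology. -/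
open Polynomial Filter Finset Metric Topology

noncomputable section

/-- The set of poles of the Padé approximants `[a; m_k/n_k]` for `k ∈ I` : the roots of
the Padé denominators. -/
def padePoles (a : ℕ → ℂ) (m n : ℕ → ℕ) (I : Set ℕ) : Set ℂ :=
  {z | ∃ k ∈ I, ∃ P Q : Polynomial ℂ, IsPade a (m k) (n k) P Q ∧ Q.eval z = 0}

/-- The set of zeros of the Padé approximants `[a; m_k/n_k]` for `k ∈ I` : the roots of
the Padé numerators. -/
def padeZeros (a : ℕ → ℂ) (m n : ℕ → ℕ) (I : Set ℕ) : Set ℂ :=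
  {z | ∃ k ∈ I, ∃ P Q : Polynomial ℂ, IsPade a (m k) (n k) P Q ∧ P.eval z = 0}

/-- The polynomial of degree at most `n` with constant term `c` whose coefficient of degree
`n - j` is `x j` for `0 ≤ j < n`. -/
def denPoly (n : ℕ) (c : ℂ) (x : Fin n → ℂ) : ℂ[X] :=
  C c + ∑ j : Fin n, C (x j) * X ^ (n - (j : ℕ))

lemma coeff_denPoly (n : ℕ) (c : ℂ) (x : Fin n → ℂ) (l : ℕ) :
    (denPoly n c x).coeff l =
      (if l = 0 then c else 0) + ∑ j : Fin n, x j * if l = n - (j : ℕ) then 1 else 0 := by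
  simp only [denPoly, coeff_add, coeff_C, finsetSum_coeff, coeff_C_mul, coeff_X_pow]

lemma natDegree_denPoly_le (n : ℕ) (c : ℂ) (x : Fin n → ℂ) : (denPoly n c x).natDegree ≤ n := by
  rw [natDegree_le_iff_coeff_eq_zero]
  intro l hl
  rw [coeff_denPoly, if_neg (by omega), zero_add]
  refine Finset.sum_eq_zero fun j _ => ?_
  rw [if_neg (by omega), mul_zero]

lemma coeff_zero_denPoly (n : ℕ) (c : ℂ) (x : Fin n → ℂ) : (denPoly n c x).coeff 0 = c := by
  rw [coeff_denPoly, if_pos rfl, Finset.sum_eq_zero, add_zero]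
  intro j _
  rw [if_neg (by omega), mul_zero]

lemma coeff_sub_denPoly (n : ℕ) (c : ℂ) (x : Fin n → ℂ) (j : Fin n) :
    (denPoly n c x).coeff (n - j) = x j := by
  rw [coeff_denPoly, if_neg (by omega), zero_add, Finset.sum_eq_single j]
  · simp
  · intro i _ hij
    rw [if_neg, mul_zero]
    intro h
    exact hij (Fin.ext (by omega))
  · simp

lemma eq_denPoly {n : ℕ} {Q : ℂ[X]} (hQ : Q.natDegree ≤ n) :
    Q = denPoly n (Q.coeff 0) fun j => Q.coeff (n - j) := by
  ext l
  rcases Nat.eq_zero_or_pos l with rfl | hl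
  · rw [coeff_zero_denPoly]
  rcases le_or_gt l n with hln | hln
  · have h := coeff_sub_denPoly n (Q.coeff 0) (fun j => Q.coeff (n - j)) ⟨n - l, by omega⟩
    simp only [show n - (n - l) = l by omega] at h
    exact h.symm
  · rw [coeff_eq_zero_of_natDegree_lt (hQ.trans_lt hln),
      coeff_eq_zero_of_natDegree_lt ((natDegree_denPoly_le _ _ _).trans_lt hln)]

lemma coeff_denPoly_mul_mk (a : ℕ → ℂ) (m n : ℕ) (c : ℂ) (x : Fin n → ℂ) (r : Fin n) :
    PowerSeries.coeff (m + 1 + r) ((denPoly n c x : PowerSeries ℂ) * PowerSeries.mk a) =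
      c * a (m + 1 + r) + (hankelMatrix a m n).mulVec x r := by
  have hcoe : (denPoly n c x : PowerSeries ℂ) = PowerSeries.C c +
      ∑ j : Fin n, PowerSeries.C (x j) * PowerSeries.X ^ (n - (j : ℕ)) := by
    rw [denPoly, Polynomial.coe_add, Polynomial.coe_C]
    congr 1
    rw [← Polynomial.coeToPowerSeries.ringHom_apply, map_sum]
    simp
  rw [hcoe, add_mul, Finset.sum_mul, map_add, map_sum, PowerSeries.coeff_C_mul,
    PowerSeries.coeff_mk, Matrix.mulVec, dotProduct]
  congr 1
  refine Finset.sum_congr rfl fun j _ => ?_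
  rw [mul_assoc, PowerSeries.coeff_C_mul, PowerSeries.coeff_X_pow_mul', mul_comm]
  congr 1
  simp only [hankelMatrix, Matrix.of_apply, acoefZ, PowerSeries.coeff_mk]
  split_ifs
  · congr 1; omega
  · omega
  · omega
  · rfl

lemma X_pow_dvd_sub_trunc {a : ℕ → ℂ} {m n : ℕ} {Q : ℂ[X]}
    (h : ∀ r : Fin n, PowerSeries.coeff (m + 1 + r) ((Q : PowerSeries ℂ) * PowerSeries.mk a) = 0) :
    (PowerSeries.X : PowerSeries ℂ) ^ (m + n + 1) ∣ (Q : PowerSeries ℂ) * PowerSeries.mk a -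
      (PowerSeries.trunc (m + 1) ((Q : PowerSeries ℂ) * PowerSeries.mk a) : ℂ[X]) := by
  rw [PowerSeries.X_pow_dvd_iff]
  intro j hj
  rw [map_sub, Polynomial.coeff_coe, PowerSeries.coeff_trunc]
  split_ifs with hjm
  · exact sub_self _
  · have := h ⟨j - (m + 1), by omega⟩
    simp only [show m + 1 + (j - (m + 1)) = j by omega] at this
    rw [this, sub_zero]

lemma eq_zero_of_coeff_zero_of_dvd {a : ℕ → ℂ} {m n : ℕ} (h : hankelDet a m n ≠ 0)
    {P Q : ℂ[X]} (hP : P.natDegree ≤ m) (hQ : Q.natDegree ≤ n) (hQ0 : Q.coeff 0 = 0)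
    (hdvd : (PowerSeries.X : PowerSeries ℂ) ^ (m + n + 1) ∣
      (Q : PowerSeries ℂ) * PowerSeries.mk a - (P : PowerSeries ℂ)) : Q = 0 := by
  have hx : (fun j : Fin n => Q.coeff (n - j)) = 0 := by
    refine Matrix.eq_zero_of_mulVec_eq_zero (M := hankelMatrix a m n) h ?_
    funext r
    have hr := (PowerSeries.X_pow_dvd_iff.1 hdvd) (m + 1 + r) (by omega)
    rw [map_sub, Polynomial.coeff_coe, coeff_eq_zero_of_natDegree_lt (by omega), sub_zero,
      eq_denPoly hQ, coeff_denPoly_mul_mk, hQ0, zero_mul, zero_add] at hr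
    exact hr
  rw [eq_denPoly hQ, hx, hQ0]
  simp [denPoly]

lemma isPade_iff {a : ℕ → ℂ} {m n : ℕ} {P Q : ℂ[X]} :
    IsPade a m n P Q ↔ P.natDegree ≤ m ∧ Q.natDegree ≤ n ∧ IsCoprime P Q ∧ Q.coeff 0 = 1 ∧
      (PowerSeries.X : PowerSeries ℂ) ^ (m + n + 1) ∣
        (Q : PowerSeries ℂ) * PowerSeries.mk a - (P : PowerSeries ℂ) := by
  have key : ∀ j, PowerSeries.coeff j ((Q : PowerSeries ℂ) * PowerSeries.mk a) =
      ∑ i ∈ Finset.range (j + 1), Q.coeff i * a (j - i) := by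
    intro j
    rw [PowerSeries.coeff_mul, Finset.Nat.sum_antidiagonal_eq_sum_range_succ_mk]
    simp
  simp only [IsPade, PowerSeries.X_pow_dvd_iff, map_sub, key, Polynomial.coeff_coe, sub_eq_zero,
    Nat.lt_succ_iff]

lemma isPade_of_dvd {a : ℕ → ℂ} {m n : ℕ} (h : hankelDet a m n ≠ 0)
    {P Q : ℂ[X]} (hP : P.natDegree ≤ m) (hQ : Q.natDegree ≤ n) (hQ0 : Q.coeff 0 = 1)
    (hdvd : (PowerSeries.X : PowerSeries ℂ) ^ (m + n + 1) ∣
      (Q : PowerSeries ℂ) * PowerSeries.mk a - (P : PowerSeries ℂ)) : IsPade a m n P Q := by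
  refine isPade_iff.2 ⟨hP, hQ, ?_, hQ0, hdvd⟩
  have hQne : Q ≠ 0 := by
    rintro rfl
    simp at hQ0
  rw [Polynomial.isCoprime_iff_aeval_ne_zero_of_isAlgClosed ℂ ℂ]
  intro z
  by_contra! hz
  obtain ⟨hPz, hQz⟩ := hz
  simp only [coe_aeval_eq_eval] at hPz hQz
  have hz0 : z ≠ 0 := by
    rintro rfl
    rw [← coeff_zero_eq_eval_zero, hQ0] at hQz
    exact one_ne_zero hQz
  obtain ⟨P', rfl⟩ := dvd_iff_isRoot.2 hPz
  obtain ⟨Q', rfl⟩ := dvd_iff_isRoot.2 hQz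
  have hQ'ne : Q' ≠ 0 := right_ne_zero_of_mul hQne
  have hunit : IsUnit (((X - C z : ℂ[X])) : PowerSeries ℂ) := by
    rw [PowerSeries.isUnit_iff_constantCoeff]
    simp [hz0]
  have hfac : (((X - C z) * Q' : ℂ[X]) : PowerSeries ℂ) * PowerSeries.mk a -
      (((X - C z) * P' : ℂ[X]) : PowerSeries ℂ) =
      ((X - C z : ℂ[X]) : PowerSeries ℂ) *
        ((Q' : PowerSeries ℂ) * PowerSeries.mk a - (P' : PowerSeries ℂ)) := by
    rw [Polynomial.coe_mul, Polynomial.coe_mul]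
    ring
  rw [hfac, hunit.dvd_mul_left] at hdvd
  refine hQ'ne ?_
  have hXQ : X * Q' = 0 := by
    refine eq_zero_of_coeff_zero_of_dvd h (P := X * P') ?_ ?_ (by simp) ?_
    · rcases eq_or_ne P' 0 with rfl | hP'
      · simp
      · rw [natDegree_mul (X_sub_C_ne_zero z) hP', natDegree_X_sub_C] at hP
        rwa [natDegree_mul X_ne_zero hP', natDegree_X]
    · rw [natDegree_mul (X_sub_C_ne_zero z) hQ'ne, natDegree_X_sub_C] at hQ
      rwa [natDegree_mul X_ne_zero hQ'ne, natDegree_X]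
    · have : ((X * Q' : ℂ[X]) : PowerSeries ℂ) * PowerSeries.mk a -
          ((X * P' : ℂ[X]) : PowerSeries ℂ) =
          PowerSeries.X * ((Q' : PowerSeries ℂ) * PowerSeries.mk a - (P' : PowerSeries ℂ)) := by
        rw [Polynomial.coe_mul, Polynomial.coe_mul, Polynomial.coe_X]
        ring
      rw [this]
      exact hdvd.mul_left _
  exact (mul_eq_zero.1 hXQ).resolve_left X_ne_zero

lemma IsPade.unique {a : ℕ → ℂ} {m n : ℕ} (h : hankelDet a m n ≠ 0) {P Q P' Q' : ℂ[X]}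
    (hPQ : IsPade a m n P Q) (hPQ' : IsPade a m n P' Q') : P = P' ∧ Q = Q' := by
  rw [isPade_iff] at hPQ hPQ'
  obtain ⟨hP, hQ, -, hQ0, hd⟩ := hPQ
  obtain ⟨hP', hQ', -, hQ0', hd'⟩ := hPQ'
  have hQQ : Q = Q' := by
    rw [← sub_eq_zero]
    refine eq_zero_of_coeff_zero_of_dvd h (P := P - P') ((natDegree_sub_le _ _).trans (by simp [*]))
      ((natDegree_sub_le _ _).trans (by simp [*])) (by simp [*]) ?_
    convert dvd_sub hd hd' using 1
    rw [Polynomial.coe_sub, Polynomial.coe_sub]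
    ring
  subst hQQ
  refine ⟨?_, rfl⟩
  ext j
  rcases le_or_gt j m with hj | hj
  · have h1 := PowerSeries.X_pow_dvd_iff.1 hd j (by omega)
    have h2 := PowerSeries.X_pow_dvd_iff.1 hd' j (by omega)
    rw [map_sub, Polynomial.coeff_coe, sub_eq_zero] at h1 h2
    rw [← h1, ← h2]
  · rw [coeff_eq_zero_of_natDegree_lt (by omega), coeff_eq_zero_of_natDegree_lt (by omega)]

/-- The coefficients, multiplied by `C_{m,n}`, of the Padé denominator, as given by Cramer's
rule. -/
def cramerVec (a : ℕ → ℂ) (m n : ℕ) : Fin n → ℂ :=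
  (hankelMatrix a m n).cramer fun r => -a (m + 1 + r)

/-- The Padé denominator multiplied by `C_{m,n}`. -/
def scaledDen (a : ℕ → ℂ) (m n : ℕ) : ℂ[X] :=
  denPoly n (hankelDet a m n) (cramerVec a m n)

/-- The Padé numerator multiplied by `C_{m,n}`. -/
def scaledNum (a : ℕ → ℂ) (m n : ℕ) : ℂ[X] :=
  PowerSeries.trunc (m + 1) ((scaledDen a m n : PowerSeries ℂ) * PowerSeries.mk a)

lemma isPade_scaled {a : ℕ → ℂ} {m n : ℕ} (h : hankelDet a m n ≠ 0) :
    IsPade a m n (C (hankelDet a m n)⁻¹ * scaledNum a m n)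
      (C (hankelDet a m n)⁻¹ * scaledDen a m n) := by
  have hdvd : (PowerSeries.X : PowerSeries ℂ) ^ (m + n + 1) ∣
      (scaledDen a m n : PowerSeries ℂ) * PowerSeries.mk a - (scaledNum a m n : ℂ[X]) := by
    refine X_pow_dvd_sub_trunc fun r => ?_
    rw [scaledDen, coeff_denPoly_mul_mk, cramerVec, Matrix.mulVec_cramer]
    simp [hankelDet, hankelMatrix]
  refine isPade_of_dvd h ?_ ?_ ?_ ?_
  · exact (natDegree_C_mul_le _ _).trans
      (Nat.lt_succ_iff.1 (PowerSeries.natDegree_trunc_lt _ _))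
  · exact (natDegree_C_mul_le _ _).trans (natDegree_denPoly_le _ _ _)
  · rw [coeff_C_mul, scaledDen, coeff_zero_denPoly, inv_mul_cancel₀ h]
  · rw [Polynomial.coe_mul, Polynomial.coe_mul, mul_assoc, ← mul_sub]
    exact hdvd.mul_left _

lemma mem_Nset_iff {a : ℕ → ℂ} {m n : ℕ} (hn : 0 < n) :
    a ∈ Nset m n ↔ hankelDet a m n ≠ 0 ∧ cramerVec a m n ⟨0, hn⟩ ≠ 0 := by
  refine and_congr_right fun h => ?_
  have hcoeff : (C (hankelDet a m n)⁻¹ * scaledDen a m n).coeff n =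
      (hankelDet a m n)⁻¹ * cramerVec a m n ⟨0, hn⟩ := by
    rw [coeff_C_mul, ← coeff_sub_denPoly n (hankelDet a m n) (cramerVec a m n) ⟨0, hn⟩]
    rfl
  constructor
  · rintro ⟨P, Q, hPQ, hdeg⟩ h0
    obtain ⟨-, rfl⟩ := hPQ.unique h (isPade_scaled h)
    refine coeff_ne_zero_of_eq_degree hdeg ?_
    rw [hcoeff, h0, mul_zero]
  · intro h0
    refine ⟨_, _, isPade_scaled h, le_antisymm ?_ ?_⟩
    · exact degree_le_of_natDegree_le (isPade_scaled h).2.1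
    · refine le_degree_of_ne_zero ?_
      rw [hcoeff]
      exact mul_ne_zero (inv_ne_zero h) h0

lemma exists_isPade_eval_eq_zero_iff {a : ℕ → ℂ} {m n : ℕ} (h : hankelDet a m n ≠ 0) (z : ℂ) :
    (∃ P Q : ℂ[X], IsPade a m n P Q ∧ P.eval z = 0) ↔ (scaledNum a m n).eval z = 0 := by
  constructor
  · rintro ⟨P, Q, hPQ, hz⟩
    obtain ⟨rfl, -⟩ := hPQ.unique h (isPade_scaled h)
    simpa [h] using hz
  · intro hz
    exact ⟨_, _, isPade_scaled h, by simp [hz]⟩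

lemma scaledNum_ne_zero {a : ℕ → ℂ} {m n : ℕ} (hn : 0 < n) (h : hankelDet a m n ≠ 0) :
    scaledNum a m n ≠ 0 := by
  intro h0
  obtain ⟨-, -, -, hQ0, hd⟩ := isPade_iff.1 (isPade_scaled h)
  rw [h0, mul_zero, Polynomial.coe_zero, sub_zero, IsUnit.dvd_mul_left,
    PowerSeries.X_pow_dvd_iff] at hd
  · refine h ?_
    have hM : hankelMatrix a m n = 0 := by
      ext i j
      simp only [hankelMatrix, Matrix.of_apply, acoefZ, Matrix.zero_apply]
      split_ifs
      · simpa using hd ((m : ℤ) - n + 1 + i + j).toNat (by omega)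
      · rfl
    have : Nonempty (Fin n) := ⟨⟨0, hn⟩⟩
    change (hankelMatrix a m n).det = 0
    rw [hM, Matrix.det_zero]
  · rw [PowerSeries.isUnit_iff_constantCoeff, ← PowerSeries.coeff_zero_eq_constantCoeff_apply,
      Polynomial.coeff_coe, hQ0]
    exact isUnit_one

lemma continuous_hankelMatrix (m n : ℕ) : Continuous fun a : ℕ → ℂ => hankelMatrix a m n := by
  refine continuous_matrix fun i j => ?_
  simp only [hankelMatrix, Matrix.of_apply, acoefZ]
  split_ifs <;> fun_prop

lemma continuous_hankelDet (m n : ℕ) : Continuous fun a : ℕ → ℂ => hankelDet a m n :=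
  (continuous_hankelMatrix m n).matrix_det

lemma continuous_cramerVec (m n : ℕ) : Continuous fun a : ℕ → ℂ => cramerVec a m n :=
  (continuous_hankelMatrix m n).matrix_cramer (by fun_prop)

lemma continuous_eval_scaledNum (m n : ℕ) :
    Continuous fun p : (ℕ → ℂ) × ℂ => (scaledNum p.1 m n).eval p.2 := by
  have h1 := continuous_hankelDet m n
  have h2 := continuous_cramerVec m n
  simp only [scaledNum, ← eval₂_id, PowerSeries.eval₂_trunc_eq_sum_range, PowerSeries.coeff_mul,
    Polynomial.coeff_coe, PowerSeries.coeff_mk, scaledDen, coeff_denPoly, RingHom.id_apply]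
  refine continuous_finsetSum _ fun i _ => Continuous.mul (continuous_finsetSum _ fun q _ =>
    Continuous.mul (Continuous.add ?_ (continuous_finsetSum _ fun j _ => ?_)) ?_) ?_
  · split_ifs
    · exact h1.comp continuous_fst
    · exact continuous_const
  · exact ((continuous_apply j).comp (h2.comp continuous_fst)).mul continuous_const
  · fun_prop
  · fun_prop

/-- A Hurwitz-type theorem: a zero of a nonzero entire function persists, in any given
neighbourhood, under perturbation of a parameter on which the function depends continuously. -/
lemma eventually_exists_zero {Y : Type*} [TopologicalSpace Y] {G : Y → ℂ → ℂ}
    (hG : Continuous fun p : Y × ℂ => G p.1 p.2) (hd : ∀ y, Differentiable ℂ (G y))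
    {y₀ : Y} (hne : G y₀ ≠ 0) {z₀ : ℂ} (hz₀ : G y₀ z₀ = 0) {U : Set ℂ} (hU : IsOpen U)
    (hzU : z₀ ∈ U) : ∀ᶠ y in 𝓝 y₀, ∃ z ∈ U, G y z = 0 := by
  have han : ∀ y, AnalyticOnNhd ℂ (G y) Set.univ := fun y => (hd y).differentiableOn.analyticOnNhd
    isOpen_univ
  have hiso : ∀ᶠ z in 𝓝[≠] z₀, G y₀ z ≠ 0 := by
    refine ((han y₀ z₀ trivial).eventually_eq_zero_or_eventually_ne_zero).resolve_left fun h => ?_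
    exact hne ((han y₀).eq_of_eventuallyEq (fun z _ => analyticAt_const) h)
  rw [eventually_nhdsWithin_iff] at hiso
  obtain ⟨ε, hε, hball⟩ := Metric.eventually_nhds_iff_ball.1 (hiso.and (hU.mem_nhds hzU))
  have hr : 0 < ε / 2 := by positivity
  have hcb : closedBall z₀ (ε / 2) ⊆ ball z₀ ε := closedBall_subset_ball (by linarith)
  have hev : ∀ᶠ y in 𝓝 y₀, ∀ z ∈ sphere z₀ (ε / 2), 2 * ‖G y z₀‖ < ‖G y z - G y z₀‖ := by
    refine (isCompact_sphere z₀ (ε / 2)).eventually_forall_of_forall_eventually fun z hz => ?_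
    have hc0 : Continuous fun p : Y × ℂ => G p.1 z₀ :=
      hG.comp (continuous_fst.prodMk continuous_const)
    refine ContinuousAt.eventually_lt (by fun_prop) (by fun_prop) ?_
    simp only [hz₀, norm_zero, mul_zero, sub_zero, norm_pos_iff]
    exact (hball z (hcb (sphere_subset_closedBall hz))).1 (ne_of_mem_sphere hz hr.ne')
  filter_upwards [hev] with y hy
  have hcy : Continuous fun z => ‖G y z - G y z₀‖ := ((hd y).continuous.sub continuous_const).norm
  obtain ⟨w, hw, hmin⟩ := (isCompact_sphere z₀ (ε / 2)).exists_isMinOn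
    (NormedSpace.sphere_nonempty.2 hr.le) hcy.continuousOn
  have hfreq : ∃ᶠ z in 𝓝 z₀, G y z ≠ G y z₀ := by
    intro hcon
    have hcst : ∀ᶠ z in 𝓝 z₀, G y z = G y z₀ := by simpa using hcon
    have := congrFun ((han y).eq_of_eventuallyEq (fun z _ => analyticAt_const) hcst) w
    have hlt := hy w hw
    rw [this, sub_self, norm_zero] at hlt
    linarith [norm_nonneg (G y z₀)]
  obtain ⟨z, hz, hz0⟩ := (hd y).diffContOnCl.ball_subset_image_closedBall hr
    (fun z hz => hmin hz) hfreq (show (0 : ℂ) ∈ ball (G y z₀) (‖G y w - G y z₀‖ / 2) by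
      rw [mem_ball, dist_zero_left]
      linarith [hy w hw])
  exact ⟨z, (hball z (hcb hz)).2, hz0⟩

lemma isOpen_Nset {n : ℕ} (m : ℕ) (hn : 0 < n) : IsOpen (Nset m n) := by
  have : Nset m n = {a | hankelDet a m n ≠ 0} ∩ {a | cramerVec a m n ⟨0, hn⟩ ≠ 0} :=
    Set.ext fun a => mem_Nset_iff hn
  rw [this]
  exact (isOpen_ne_fun (continuous_hankelDet m n) continuous_const).inter
    (isOpen_ne_fun ((continuous_apply _).comp (continuous_cramerVec m n)) continuous_const)

/-- The set of series in `𝒟_{m,n}` whose Padé approximant of type `(m,n)` has a zero in `U`. -/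
def zeroIn (m n : ℕ) (U : Set ℂ) : Set (ℕ → ℂ) :=
  {a | hankelDet a m n ≠ 0 ∧ ∃ z ∈ U, (scaledNum a m n).eval z = 0}

lemma isOpen_zeroIn {n : ℕ} (m : ℕ) (hn : 0 < n) {U : Set ℂ} (hU : IsOpen U) :
    IsOpen (zeroIn m n U) := by
  rw [isOpen_iff_eventually]
  rintro a ⟨ha, z, hzU, hz⟩
  refine Filter.Eventually.and
    ((isOpen_ne_fun (continuous_hankelDet m n) continuous_const).eventually_mem ha) ?_
  refine eventually_exists_zero (G := fun b z => (scaledNum b m n).eval z)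
    (continuous_eval_scaledNum m n) (fun b => Polynomial.differentiable _) ?_ hz hU hzU
  intro h0
  exact scaledNum_ne_zero hn ha (Polynomial.funext fun z => by simpa using congrFun h0 z)

lemma dense_eval_ne_zero {p : ℂ[X]} (hp : p ≠ 0) : Dense {z : ℂ | p.eval z ≠ 0} :=
  Set.Countable.dense_compl ℂ (Polynomial.finite_setOfPred_isRoot hp).countable

/-- The nonvanishing set of a function that is polynomial along lines is dense as soon as it is
nonempty. -/
lemma dense_ne_zero_of_polynomial_on_lines {E : Type*} [AddCommGroup E] [Module ℂ E]
    [TopologicalSpace E] [ContinuousAdd E] [ContinuousSMul ℂ E] {F : E → ℂ}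
    (hF : ∀ a b : E, ∃ p : ℂ[X], ∀ s : ℂ, F (a + s • b) = p.eval s) {b₀ : E} (hb₀ : F b₀ ≠ 0) :
    Dense {a | F a ≠ 0} := by
  intro a
  obtain ⟨p, hp⟩ := hF a (b₀ - a)
  have hp0 : p ≠ 0 := by
    rintro rfl
    have := hp 1
    simp [hb₀] at this
  have hd := dense_eval_ne_zero hp0
  have hc : Continuous fun s : ℂ => a + s • (b₀ - a) := by fun_prop
  have := map_mem_closure hc (hd 0) (t := {a | F a ≠ 0}) fun s hs => by
    simpa [hp] using hs
  simpa using this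

lemma exists_polynomial_acoefZ (a b : ℕ → ℂ) (k : ℤ) :
    ∃ p : ℂ[X], ∀ s : ℂ, acoefZ (a + s • b) k = p.eval s := by
  refine ⟨C (acoefZ a k) + X * C (acoefZ b k), fun s => ?_⟩
  simp only [acoefZ]
  split_ifs
  · simp only [Pi.add_apply, Pi.smul_apply, smul_eq_mul, eval_add, eval_mul, eval_C, eval_X]
  · simp

lemma exists_polynomial_det {n : ℕ} {M : (ℕ → ℂ) → Matrix (Fin n) (Fin n) ℂ}
    (hM : ∀ a b i j, ∃ p : ℂ[X], ∀ s : ℂ, M (a + s • b) i j = p.eval s) (a b : ℕ → ℂ) :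
    ∃ p : ℂ[X], ∀ s : ℂ, (M (a + s • b)).det = p.eval s := by
  choose p hp using hM a b
  refine ⟨(Matrix.of p).det, fun s => ?_⟩
  rw [← coe_evalRingHom, RingHom.map_det]
  congr 1
  ext i j
  simp [hp]

lemma exists_mem_Nset {n : ℕ} (m : ℕ) (hn : 0 < n) : ∃ b, b ∈ Nset m n := by
  set b : ℕ → ℂ := fun k => if k = m ∨ k = m + n then 1 else 0 with hb
  have hmul : ∀ (x : Fin n → ℂ) (r : Fin n), (hankelMatrix b m n).mulVec x r = x r.rev := by
    intro x r
    rw [Matrix.mulVec, dotProduct, Finset.sum_eq_single r.rev]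
    · have : (hankelMatrix b m n) r r.rev = 1 := by
        have h := Fin.val_rev r
        simp only [hankelMatrix, Matrix.of_apply, acoefZ, hb]
        rw [if_pos (by omega), if_pos (by omega)]
      rw [this, one_mul]
    · intro j _ hj
      have : (hankelMatrix b m n) r j = 0 := by
        have h := Fin.val_rev r
        have hj' : (j : ℕ) ≠ r.rev := fun h => hj (Fin.ext h)
        simp only [hankelMatrix, Matrix.of_apply, acoefZ, hb]
        split_ifs
        · omega
        · rfl
        · rfl
      rw [this, zero_mul]
    · simp
  have hdet : hankelDet b m n ≠ 0 := by
    intro h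
    obtain ⟨v, hv, hv0⟩ := Matrix.exists_mulVec_eq_zero_iff.2
      (show (hankelMatrix b m n).det = 0 from h)
    refine hv (funext fun i => ?_)
    have := congrFun hv0 i.rev
    rwa [hmul, Fin.rev_rev] at this
  refine ⟨b, (mem_Nset_iff hn).2 ⟨hdet, ?_⟩⟩
  have h1 := hmul (cramerVec b m n) (Fin.rev ⟨0, hn⟩)
  rw [Fin.rev_rev] at h1
  rw [← h1, cramerVec, Matrix.mulVec_cramer, Pi.smul_apply, smul_eq_mul]
  refine mul_ne_zero hdet ?_
  have h := Fin.val_rev (⟨0, hn⟩ : Fin n)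
  simp only [hb]
  rw [if_pos (by simp only at h; omega)]
  simp

lemma dense_Nset {n : ℕ} (m : ℕ) (hn : 0 < n) : Dense (Nset m n) := by
  obtain ⟨b, hb⟩ := exists_mem_Nset m hn
  have hset : Nset m n = {a | hankelDet a m n * cramerVec a m n ⟨0, hn⟩ ≠ 0} :=
    Set.ext fun a => (mem_Nset_iff hn).trans mul_ne_zero_iff.symm
  have hM : ∀ (a b : ℕ → ℂ) (i j : Fin n),
      ∃ p : ℂ[X], ∀ s : ℂ, hankelMatrix (a + s • b) m n i j = p.eval s := fun a b i j =>
    exists_polynomial_acoefZ a b _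
  rw [hset] at hb ⊢
  refine dense_ne_zero_of_polynomial_on_lines (fun a b => ?_) hb
  obtain ⟨p, hp⟩ := exists_polynomial_det (M := fun a => hankelMatrix a m n) hM a b
  obtain ⟨q, hq⟩ := exists_polynomial_det
    (M := fun a => (hankelMatrix a m n).updateCol ⟨0, hn⟩ fun r => -a (m + 1 + r))
    (fun a b i j => by
      by_cases hj : j = ⟨0, hn⟩
      · subst hj
        refine ⟨-C (a (m + 1 + i)) - X * C (b (m + 1 + i)), fun s => ?_⟩
        simp only [Matrix.updateCol_self, Pi.add_apply, Pi.smul_apply, smul_eq_mul, eval_sub,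
          eval_neg, eval_mul, eval_C, eval_X]
        ring
      · simp only [Matrix.updateCol_ne hj]
        exact hM a b i j) a b
  refine ⟨p * q, fun s => ?_⟩
  rw [eval_mul, ← hp, ← hq, cramerVec, Matrix.cramer_apply]
  rfl

lemma hankelDet_congr {a b : ℕ → ℂ} {m n : ℕ} (h : ∀ k < m + n, a k = b k) :
    hankelDet a m n = hankelDet b m n := by
  unfold hankelDet
  congr 1
  ext i j
  simp only [Matrix.of_apply, acoefZ]
  split_ifs
  · exact h _ (by omega)
  · rfl

/-- Changing only the coefficient of degree `m + n` of a generic series, one can create a zero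
of the Padé approximant of type `(m,n)` in any given nonempty open set. -/
lemma exists_update_mem_zeroIn {a : ℕ → ℂ} {m n : ℕ} (hm : 0 < m) (hn : 0 < n)
    (ha : hankelDet a m n ≠ 0) (ha0 : a 0 ≠ 0) {U : Set ℂ} (hU : IsOpen U) (hne : U.Nonempty) :
    ∃ t : ℂ, Function.update a (m + n) t ∈ zeroIn m n U := by
  obtain ⟨hP₀, hQ₀, -, hQ₀1, hd₀⟩ := isPade_iff.1 (isPade_scaled ha)
  set P₀ := C (hankelDet a m n)⁻¹ * scaledNum a m n
  set Q₀ := C (hankelDet a m n)⁻¹ * scaledDen a m n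
  set F := PowerSeries.mk a with hF
  obtain ⟨x, hx⟩ := (Matrix.mulVec_surjective_iff_isUnit.2
    ((hankelMatrix a m n).isUnit_iff_isUnit_det.2 (isUnit_iff_ne_zero.2 ha)))
    (fun r : Fin n => if (r : ℕ) + 1 = n then (1 : ℂ) else 0)
  set Q₁ := denPoly n 0 x
  set P₁ : ℂ[X] := PowerSeries.trunc (m + 1) ((Q₁ : PowerSeries ℂ) * F)
  have hQ₁ : Q₁.natDegree ≤ n := natDegree_denPoly_le _ _ _
  have hQ₁0 : Q₁.coeff 0 = 0 := coeff_zero_denPoly _ _ _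
  have hP₁ : P₁.natDegree ≤ m := Nat.lt_succ_iff.1 (PowerSeries.natDegree_trunc_lt _ _)
  have hd₁ : (PowerSeries.X : PowerSeries ℂ) ^ (m + n + 1) ∣
      (Q₁ : PowerSeries ℂ) * F - (P₁ : PowerSeries ℂ) - PowerSeries.X ^ (m + n) := by
    rw [PowerSeries.X_pow_dvd_iff]
    intro j hj
    rw [map_sub, map_sub, Polynomial.coeff_coe, PowerSeries.coeff_trunc, PowerSeries.coeff_X_pow]
    rcases Nat.lt_or_ge j (m + 1) with hjm | hjm
    · rw [if_pos hjm, if_neg (by omega)]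
      simp
    · have h := coeff_denPoly_mul_mk a m n 0 x ⟨j - (m + 1), by omega⟩
      rw [hx] at h
      simp only [show m + 1 + (j - (m + 1)) = j by omega, zero_mul, zero_add] at h
      rw [if_neg (by omega), h]
      split_ifs <;> first | omega | simp
  have hP₁ne : P₁ ≠ 0 := by
    intro h0
    have hunit : IsUnit F := by
      rw [PowerSeries.isUnit_iff_constantCoeff]
      simpa [hF, ← PowerSeries.coeff_zero_eq_constantCoeff_apply] using ha0
    rw [h0, Polynomial.coe_zero, sub_zero] at hd₁
    have h1 : (PowerSeries.X : PowerSeries ℂ) ^ (m + n) ∣ (Q₁ : PowerSeries ℂ) := by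
      rw [← hunit.dvd_mul_right]
      have h2 := (pow_dvd_pow (PowerSeries.X : PowerSeries ℂ) (Nat.le_succ (m + n))).trans hd₁
      exact (dvd_sub_left dvd_rfl).1 h2
    have h3 : Q₁ = 0 := by
      ext l
      rcases Nat.lt_or_ge l (m + n) with hl | hl
      · simpa using PowerSeries.X_pow_dvd_iff.1 h1 l hl
      · rw [coeff_eq_zero_of_natDegree_lt (by omega), coeff_zero]
    rw [h3, Polynomial.coe_zero, zero_mul, zero_sub] at hd₁
    have := PowerSeries.X_pow_dvd_iff.1 hd₁ (m + n) (by omega)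
    simp at this
  obtain ⟨w, hw, hwU⟩ : ∃ w, P₁.eval w ≠ 0 ∧ w ∈ U := by
    obtain ⟨w, hw⟩ := (dense_eval_ne_zero hP₁ne).inter_open_nonempty U hU hne
    exact ⟨w, hw.2, hw.1⟩
  set t := -P₀.eval w / P₁.eval w
  set a' := Function.update a (m + n) (a (m + n) - t) with ha'
  have hdet : hankelDet a' m n ≠ 0 := by
    rwa [hankelDet_congr (b := a)]
    intro k hk
    rw [ha', Function.update_of_ne hk.ne]
  have hmk : PowerSeries.mk a' = F - PowerSeries.C t * PowerSeries.X ^ (m + n) := by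
    ext j
    rw [map_sub, PowerSeries.coeff_C_mul, PowerSeries.coeff_X_pow, hF, PowerSeries.coeff_mk,
      PowerSeries.coeff_mk, ha', Function.update_apply]
    split_ifs with h <;> simp [h]
  have hpade : IsPade a' m n (P₀ + C t * P₁) (Q₀ + C t * Q₁) := by
    refine isPade_of_dvd hdet ?_ ?_ (by simp [hQ₀1, hQ₁0]) ?_
    · exact natDegree_add_le_of_degree_le hP₀ ((natDegree_C_mul_le _ _).trans hP₁)
    · exact natDegree_add_le_of_degree_le hQ₀ ((natDegree_C_mul_le _ _).trans hQ₁)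
    · have hX : (PowerSeries.X : PowerSeries ℂ) ∣
          ((Q₀ + C t * Q₁ : ℂ[X]) : PowerSeries ℂ) - 1 := by
        rw [PowerSeries.X_dvd_iff, map_sub, ← PowerSeries.coeff_zero_eq_constantCoeff_apply,
          Polynomial.coeff_coe]
        simp [hQ₀1, hQ₁0]
      have hX' : (PowerSeries.X : PowerSeries ℂ) ^ (m + n + 1) ∣ PowerSeries.X ^ (m + n) *
          (((Q₀ + C t * Q₁ : ℂ[X]) : PowerSeries ℂ) - 1) := by
        rw [pow_succ]
        exact mul_dvd_mul_left _ hX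
      have hsum := ((hd₀.add (hd₁.mul_left (PowerSeries.C t))).sub
        (hX'.mul_left (PowerSeries.C t)))
      convert hsum using 1
      rw [hmk]
      simp only [Polynomial.coe_add, Polynomial.coe_mul, Polynomial.coe_C]
      ring
  refine ⟨_, hdet, w, hwU, (exists_isPade_eval_eq_zero_iff hdet w).1 ⟨_, _, hpade, ?_⟩⟩
  simp only [eval_add, eval_mul, eval_C, t]
  field_simp
  ring

lemma dense_iUnion_zeroIn {m n : ℕ → ℕ} (hm : ∀ k, 0 < m k) (hn : ∀ k, 0 < n k)
    (hub : ∀ N : ℕ, ∃ k, N < m k + n k) {U : Set ℂ} (hU : IsOpen U) (hne : U.Nonempty) :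
    Dense (⋃ k, zeroIn (m k) (n k) U) := by
  rw [dense_iff_inter_open]
  rintro V hV ⟨a, haV⟩
  obtain ⟨I, u, hu, hIV⟩ := isOpen_pi_iff.1 hV a haV
  obtain ⟨k, hk⟩ := hub (I.sup id)
  have hopen : IsOpen ((I : Set ℕ).pi u) := isOpen_set_pi I.finite_toSet fun i hi => (hu i hi).1
  have hdense : Dense (Nset (m k) (n k) ∩ {b : ℕ → ℂ | b 0 ≠ 0}) :=
    (dense_Nset (m k) (hn k)).inter_of_isOpen_left
      ((dense_compl_singleton (0 : ℂ)).preimage (isOpenMap_eval 0)) (isOpen_Nset (m k) (hn k))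
  obtain ⟨b, hbI, hb, hb0⟩ := hdense.inter_open_nonempty _ hopen ⟨a, fun i hi => (hu i hi).2⟩
  obtain ⟨t, ht⟩ := exists_update_mem_zeroIn (hm k) (hn k) hb.1 hb0 hU hne
  refine ⟨_, hIV fun i hi => ?_, Set.mem_iUnion.2 ⟨k, ht⟩⟩
  have hik : i ≤ I.sup id := Finset.le_sup (f := id) hi
  rw [Function.update_of_ne (by omega)]
  exact hbI i hi

lemma setOf_dense_padeZeros_eq {m n : ℕ → ℕ} :
    {a : ℕ → ℂ | (∀ k, a ∈ Nset (m k) (n k)) ∧ Dense (padeZeros a m n Set.univ)} =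
      (⋂ k, Nset (m k) (n k)) ∩
        ⋂ U ∈ {U ∈ TopologicalSpace.countableBasis ℂ | U.Nonempty},
          ⋃ k, zeroIn (m k) (n k) U := by
  ext a
  simp only [Set.mem_ofPred_eq, Set.mem_inter_iff, Set.mem_iInter, Set.mem_iUnion]
  refine and_congr_right fun ha => ?_
  rw [(TopologicalSpace.isBasis_countableBasis ℂ).dense_iff]
  simp only [and_imp]
  refine forall₃_congr fun U _ _ => ?_
  constructor
  · rintro ⟨z, hzU, k, -, hz⟩
    exact ⟨k, (ha k).1, z, hzU, (exists_isPade_eval_eq_zero_iff (ha k).1 z).1 hz⟩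
  · rintro ⟨k, hk, z, hzU, hz⟩
    exact ⟨z, hzU, k, trivial, (exists_isPade_eval_eq_zero_iff hk z).2 hz⟩

/-- Theorem 3.1 (ii) : if `(m_k + n_k)_k` is unbounded, the set `𝔽^𝒵_𝒮` of formal power
series `f` belonging to every `𝒩_{m_k,n_k}` and whose Padé approximants `[f; m_k/n_k]`,
`k ≥ 0`, have a set of zeros dense in `ℂ`, is a dense `G_δ` subset of `𝔽 = ℂ^ℕ` with
the product topology. -/
theorem stmt_4 (m n : ℕ → ℕ) (hm : ∀ k, 0 < m k) (hn : ∀ k, 0 < n k)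
    (hub : ∀ N : ℕ, ∃ k, N < m k + n k) :
    IsGδ {a : ℕ → ℂ | (∀ k, a ∈ Nset (m k) (n k)) ∧ Dense (padeZeros a m n Set.univ)} ∧
    Dense {a : ℕ → ℂ | (∀ k, a ∈ Nset (m k) (n k)) ∧ Dense (padeZeros a m n Set.univ)} := by
  have hcount : {U ∈ TopologicalSpace.countableBasis ℂ | U.Nonempty}.Countable :=
    (TopologicalSpace.countable_countableBasis ℂ).mono fun U hU => hU.1
  have hN : ∀ k, IsOpen (Nset (m k) (n k)) := fun k => isOpen_Nset (m k) (hn k)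
  have hZ : ∀ U ∈ {U ∈ TopologicalSpace.countableBasis ℂ | U.Nonempty},
      IsOpen (⋃ k, zeroIn (m k) (n k) U) := fun U hU => isOpen_iUnion fun k =>
    isOpen_zeroIn (m k) (hn k) (TopologicalSpace.isOpen_of_mem_countableBasis hU.1)
  have hGN : IsGδ (⋂ k, Nset (m k) (n k)) := IsGδ.iInter_of_isOpen hN
  have hGZ : IsGδ (⋂ U ∈ {U ∈ TopologicalSpace.countableBasis ℂ | U.Nonempty},
      ⋃ k, zeroIn (m k) (n k) U) := IsGδ.biInter_of_isOpen hcount hZ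
  rw [setOf_dense_padeZeros_eq]
  refine ⟨hGN.inter hGZ, Dense.inter_of_Gδ hGN hGZ ?_ ?_⟩
  · exact dense_iInter_of_isOpen hN fun k => dense_Nset (m k) (hn k)
  · exact dense_biInter_of_isOpen hZ hcount fun U hU => dense_iUnion_zeroIn hm hn hub
      (TopologicalSpace.isOpen_of_mem_countableBasis hU.1) hU.2

end
end
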